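/- arXiv:1711.11176 — 4 statements merged into one kernel-verified Lean document; each statement's English description precedes it below -/
import Mathlib

section
/- Let d ≥ 2 and let P_1, …, P_{d−2} be positive semidefinite real symmetric d×d matrices. Define the symmetric bilinear form HR(P) on the real vector space Sym_d of real symmetric d×d matrices by HR(P)(η_1, η_2) = D(η_1, η_2, P_1, …, P_{d−2}). If HR(P) is not identically zero, then HR(P) has exactly one positive eigenvalue; that is, there exists a one-dimensional linear subspace of Sym_d on which the quadratic form η ↦ HR(P)(η, η) is positive definite, but there is no two-dimensional linear subspace of Sym_d on which it is positive definite. -/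
open Matrix

/-- The mixed discriminant of `d` real `d × d` matrices:
`D(A_1, …, A_d) = ∑_{S ⊆ {1,…,d}} (−1)^{d−|S|} det(∑_{i∈S} A_i)`. -/
noncomputable def mixedDiscriminant {d : ℕ} (A : Fin d → Matrix (Fin d) (Fin d) ℝ) : ℝ :=
  ∑ S : Finset (Fin d), (-1 : ℝ) ^ (d - S.card) * (∑ i ∈ S, A i).det

/-- The polarization of the determinant. -/
noncomputable def polarizedDet (R ι : Type*) [CommRing R] [Fintype ι] [DecidableEq ι] :
    MultilinearMap R (fun _ : ι => Matrix ι ι R) R :=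
  ∑ σ : Equiv.Perm ι, ((detRowAlternating (R := R) (n := ι)).toMultilinearMap.compLinearMap
    fun i => (LinearMap.proj i : (ι → ι → R) →ₗ[R] ι → R)).domDomCongr σ

section PolarizedDet

variable {R ι : Type*} [CommRing R] [Fintype ι] [DecidableEq ι]

lemma polarizedDet_apply (A : ι → Matrix ι ι R) :
    polarizedDet R ι A = ∑ σ : Equiv.Perm ι, det (of fun i => A (σ i) i) := by
  simp only [polarizedDet, _root_.sum_apply]
  rfl

lemma polarizedDet_comp_perm (A : ι → Matrix ι ι R) (τ : Equiv.Perm ι) :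
    polarizedDet R ι (A ∘ τ) = polarizedDet R ι A := by
  simp only [polarizedDet_apply]
  exact Fintype.sum_equiv (Equiv.mulLeft τ) _ _ fun σ => rfl

lemma polarizedDet_const (Z : Matrix ι ι R) :
    polarizedDet R ι (fun _ => Z) = ((Fintype.card ι).factorial : R) * det Z := by
  rw [polarizedDet_apply, Finset.sum_const, Finset.card_univ, Fintype.card_perm, nsmul_eq_mul]
  rfl

lemma polarizedDet_map {S : Type*} [CommRing S] (f : R →+* S) (A : ι → Matrix ι ι R) :
    polarizedDet S ι (fun i => (A i).map f) = f (polarizedDet R ι A) := by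
  simp only [polarizedDet_apply, map_sum, RingHom.map_det]
  rfl

lemma polarizedDet_vecMulVec (v : ι → ι → R) :
    polarizedDet R ι (fun i => vecMulVec (v i) (v i)) = det (of v) ^ 2 := by
  rw [polarizedDet_apply, sq]
  nth_rw 1 [det_apply']
  rw [Finset.sum_mul]
  refine Finset.sum_congr rfl fun σ _ => ?_
  have h : (of fun i => vecMulVec (v (σ i)) (v (σ i)) i) =
      of fun i j => v (σ i) i * (of v).submatrix σ id i j := by
    ext i j; simp [vecMulVec]
  rw [h, det_mul_column, det_permute]
  simp only [of_apply]
  rw [mul_left_comm, mul_assoc]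

lemma polarizedDet_eq_sum_det (A : ι → Matrix ι ι R) :
    polarizedDet R ι A =
      ∑ S : Finset ι, (-1 : R) ^ (Fintype.card ι - S.card) * (∑ i ∈ S, A i).det := by
  have hdet : ∀ S : Finset ι, (∑ i ∈ S, A i).det =
      ∑ f : ι → ι, (if ∀ i, f i ∈ S then 1 else 0) * det (of fun i => A (f i) i) := by
    intro S
    have h1 : (∑ i ∈ S, A i) = of fun i => ∑ k ∈ S, A k i := by
      ext i j; simp [Matrix.sum_apply]
    have h2 := (detRowAlternating (R := R) (n := ι)).toMultilinearMap.map_sum_finset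
      (fun i k => A k i) (fun _ => S)
    rw [h1]
    refine h2.trans ?_
    simp only [ite_mul, one_mul, zero_mul, ← Finset.sum_filter]
    refine Finset.sum_congr ?_ fun _ _ => rfl
    ext f; simp [Fintype.mem_piFinset]
  have hsign : ∀ f : ι → ι, ∑ S : Finset ι,
      (-1 : R) ^ (Fintype.card ι - S.card) * (if ∀ i, f i ∈ S then 1 else 0) =
      if Function.Bijective f then 1 else 0 := by
    intro f
    have h := Finset.prod_add (fun _ : ι => (1 : R))
      (fun j => if ∃ i, f i = j then 0 else -1) Finset.univ
    rw [Finset.powerset_univ] at h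
    have hl : ∏ j, ((1 : R) + if ∃ i, f i = j then 0 else -1) =
        if Function.Bijective f then 1 else 0 := by
      split_ifs with hf
      · exact Finset.prod_eq_one fun j _ => by simp [hf.2 j]
      · obtain ⟨j, hj⟩ := not_forall.1 (mt Finite.surjective_iff_bijective.1 hf)
        exact Finset.prod_eq_zero (Finset.mem_univ j) (by rw [if_neg hj]; ring)
    rw [← hl, h]
    refine Finset.sum_congr rfl fun S _ => ?_
    rw [Finset.prod_const_one, one_mul]
    split_ifs with hS
    · rw [mul_one, ← Finset.card_univ, ← Finset.card_sdiff_of_subset (Finset.subset_univ S),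
        ← Finset.prod_const]
      refine Finset.prod_congr rfl fun j hj => ?_
      rw [if_neg]
      rintro ⟨i, rfl⟩
      exact (Finset.mem_sdiff.1 hj).2 (hS i)
    · obtain ⟨i, hi⟩ := not_forall.1 hS
      rw [mul_zero, eq_comm]
      exact Finset.prod_eq_zero (i := f i) (by simp [hi]) (if_pos ⟨i, rfl⟩)
  simp only [hdet, Finset.mul_sum]
  rw [Finset.sum_comm]
  have hsum : ∀ f : ι → ι, ∑ S : Finset ι, (-1 : R) ^ (Fintype.card ι - S.card) *
      ((if ∀ i, f i ∈ S then 1 else 0) * det (of fun i => A (f i) i)) =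
      if Function.Bijective f then det (of fun i => A (f i) i) else 0 := by
    intro f
    simp only [← mul_assoc]
    rw [← Finset.sum_mul, hsign f, ite_mul, one_mul, zero_mul]
  rw [Finset.sum_congr rfl fun f _ => hsum f, ← Finset.sum_filter, polarizedDet_apply]
  refine Finset.sum_bij (fun σ _ => σ) (by simp) (by simp) ?_ (by simp)
  intro f hf
  exact ⟨Equiv.ofBijective f (Finset.mem_filter.1 hf).2, Finset.mem_univ _, rfl⟩

end PolarizedDet

lemma polarizedDet_nonneg {ι : Type*} [Fintype ι] [DecidableEq ι] {A : ι → Matrix ι ι ℝ}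
    (hA : ∀ i, (A i).PosSemidef) : 0 ≤ polarizedDet ℝ ι A := by
  choose m v hv using fun i => posSemidef_iff_eq_sum_vecMulVec.1 (hA i)
  rw [funext hv, MultilinearMap.map_sum]
  refine Finset.sum_nonneg fun f _ => ?_
  simp only [star_trivial]
  rw [polarizedDet_vecMulVec (fun i => v i (f i))]
  positivity

section Stability

open Polynomial in
/-- A consequence of the Gauss–Lucas theorem. -/
lemma Polynomial.coeff_one_ne_zero_of_eval_ne_zero {p : ℂ[X]} (hdeg : 0 < p.degree)
    (hp : ∀ s : ℂ, 0 ≤ s.im → p.eval s ≠ 0) : p.coeff 1 ≠ 0 := by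
  intro h
  have hd : p.derivative ≠ 0 := fun h0 =>
    (natDegree_pos_iff_degree_pos.2 hdeg).ne' (derivative_eq_zero.1 h0)
  have h0 : (0 : ℂ) ∈ p.derivative.rootSet ℂ := by
    rw [mem_rootSet]
    refine ⟨hd, ?_⟩
    simp [← coeff_zero_eq_eval_zero, coeff_derivative, h]
  have hsub : p.rootSet ℂ ⊆ {z | z.im < 0} := fun z hz => by
    rw [mem_rootSet] at hz
    by_contra hz'
    exact hp z (not_lt.1 hz') (by simpa using hz.2)
  have := convexHull_min hsub (convex_halfSpace_im_lt 0)
    (rootSet_derivative_subset_convexHull_rootSet hdeg h0)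
  simp at this

variable {ι : Type*} [Fintype ι]

/-- The Siegel upper half space: the complex symmetric matrices with positive definite
imaginary part. -/
def siegelUpperHalfSpace (ι : Type*) [Fintype ι] : Set (Matrix ι ι ℂ) :=
  {Z | ∃ X Y : Matrix ι ι ℝ, X.IsSymm ∧ Y.PosDef ∧
    Z = X.map Complex.ofRealHom + Complex.I • Y.map Complex.ofRealHom}

lemma add_smul_mem_siegelUpperHalfSpace {Z : Matrix ι ι ℂ} (hZ : Z ∈ siegelUpperHalfSpace ι)
    {P : Matrix ι ι ℝ} (hP : P.PosSemidef) {s : ℂ} (hs : 0 ≤ s.im) :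
    Z + s • P.map Complex.ofRealHom ∈ siegelUpperHalfSpace ι := by
  obtain ⟨X, Y, hX, hY, rfl⟩ := hZ
  have hPs : P.IsSymm := by simpa using hP.isHermitian
  refine ⟨X + s.re • P, Y + s.im • P, hX.add (hPs.smul _), hY.add_posSemidef (hP.smul hs), ?_⟩
  ext i j
  apply Complex.ext <;> simp

variable [DecidableEq ι]

lemma det_ne_zero_of_mem_siegelUpperHalfSpace {Z : Matrix ι ι ℂ}
    (hZ : Z ∈ siegelUpperHalfSpace ι) : Z.det ≠ 0 := by
  obtain ⟨X, Y, hX, hY, rfl⟩ := hZ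
  intro h
  obtain ⟨v, hv0, hv⟩ := exists_mulVec_eq_zero_iff.2 h
  set a : ι → ℝ := fun i => (v i).re
  set b : ι → ℝ := fun i => (v i).im
  have h1 : X *ᵥ a = Y *ᵥ b := by
    ext i
    have := congrArg Complex.re (congrFun hv i)
    simp [mulVec, dotProduct, Finset.sum_sub_distrib] at this
    simp only [mulVec, dotProduct, a, b]
    linarith
  have h2 : X *ᵥ b = - Y *ᵥ a := by
    ext i
    have := congrArg Complex.im (congrFun hv i)
    simp [mulVec, dotProduct, Finset.sum_add_distrib] at this
    simp [mulVec, dotProduct, a, b]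
    linarith
  have h3 : b ⬝ᵥ X *ᵥ a = a ⬝ᵥ X *ᵥ b := by
    rw [dotProduct_mulVec, ← mulVec_transpose, hX.eq, dotProduct_comm]
  rw [h1, h2, neg_mulVec, dotProduct_neg] at h3
  have ha := hY.posSemidef.dotProduct_mulVec_nonneg a
  have hb := hY.posSemidef.dotProduct_mulVec_nonneg b
  simp only [star_trivial] at ha hb
  have ha0 : a = 0 := by
    by_contra h0
    have := hY.dotProduct_mulVec_pos h0
    simp only [star_trivial] at this
    linarith
  have hb0 : b = 0 := by
    by_contra h0
    have := hY.dotProduct_mulVec_pos h0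
    simp only [star_trivial] at this
    linarith
  exact hv0 (funext fun i => Complex.ext (congrFun ha0 i) (congrFun hb0 i))

lemma polarizedDet_piecewise_add_smul {R : Type*} [CommRing R] (T : Finset ι)
    (P : ι → Matrix ι ι R) (Z W : Matrix ι ι R) (s : R) :
    polarizedDet R ι (T.piecewise P fun _ => Z + s • W) = ∑ S ∈ Tᶜ.powerset,
      polarizedDet R ι (S.piecewise (fun _ => W) (T.piecewise P fun _ => Z)) * s ^ S.card := by
  have h : (T.piecewise P fun _ => Z + s • W) =
      Tᶜ.piecewise ((fun _ => s • W) + T.piecewise P fun _ => Z) (T.piecewise P fun _ => Z) := by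
    ext1 i
    by_cases hi : i ∈ T <;> simp [hi, add_comm]
  rw [h, MultilinearMap.map_piecewise_add]
  refine Finset.sum_congr rfl fun S _ => ?_
  have h' : S.piecewise (fun _ => s • W) (T.piecewise P fun _ => Z) =
      S.piecewise (fun i => s • S.piecewise (fun _ => W) (T.piecewise P fun _ => Z) i)
        (S.piecewise (fun _ => W) (T.piecewise P fun _ => Z)) := by
    ext1 i
    by_cases hi : i ∈ S <;> simp [hi]
  rw [h', MultilinearMap.map_piecewise_smul]
  simp [mul_comm]

/-- Mixed discriminants with some arguments positive definite and the others equal to a common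
point of the Siegel upper half space do not vanish. -/
theorem polarizedDet_piecewise_ne_zero {P : ι → Matrix ι ι ℝ} (hP : ∀ i, (P i).PosDef)
    (T : Finset ι) {Z : Matrix ι ι ℂ} (hZ : Z ∈ siegelUpperHalfSpace ι) :
    polarizedDet ℂ ι (T.piecewise (fun i => (P i).map Complex.ofRealHom) fun _ => Z) ≠ 0 := by
  set Q : ι → Matrix ι ι ℂ := fun i => (P i).map Complex.ofRealHom with hQ
  induction T using Finset.induction_on generalizing Z with
  | empty =>
    rw [Finset.piecewise_empty, polarizedDet_const]
    exact mul_ne_zero (by exact_mod_cast Nat.factorial_ne_zero _)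
      (det_ne_zero_of_mem_siegelUpperHalfSpace hZ)
  | insert j T hj ih =>
    set p : Polynomial ℂ := ∑ S ∈ Tᶜ.powerset, Polynomial.C
      (polarizedDet ℂ ι (S.piecewise (fun _ => Q j) (T.piecewise Q fun _ => Z))) *
        Polynomial.X ^ S.card with hp
    have hcoeff : ∀ k, p.coeff k = ∑ S ∈ Tᶜ.powersetCard k,
        polarizedDet ℂ ι (S.piecewise (fun _ => Q j) (T.piecewise Q fun _ => Z)) := by
      intro k
      simp only [hp, Polynomial.finsetSum_coeff, Polynomial.coeff_C_mul_X_pow,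
        Finset.powersetCard_eq_filter, Finset.sum_filter, eq_comm]
    have heval : ∀ s : ℂ, p.eval s = polarizedDet ℂ ι (T.piecewise Q fun _ => Z + s • Q j) := by
      intro s
      simp [hp, Polynomial.eval_finsetSum, polarizedDet_piecewise_add_smul]
    have hjT : j ∈ Tᶜ := Finset.mem_compl.2 hj
    have htop : p.coeff Tᶜ.card ≠ 0 := by
      have hI := ih (Z := Complex.I • Q j)
        ⟨0, P j, isSymm_zero, hP j, by ext; simp [hQ]⟩
      have h : (T.piecewise Q fun _ => Complex.I • Q j) =
          Tᶜ.piecewise (fun i => Complex.I • T.piecewise Q (fun _ => Q j) i)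
            (T.piecewise Q fun _ => Q j) := by
        ext1 i
        by_cases hi : i ∈ T <;> simp [hi]
      rw [h, MultilinearMap.map_piecewise_smul] at hI
      have h' : Tᶜ.piecewise (fun _ => Q j) (T.piecewise Q fun _ => Z) =
          T.piecewise Q fun _ => Q j := by
        ext1 i
        by_cases hi : i ∈ T <;> simp [hi]
      rw [hcoeff, Finset.powersetCard_self, Finset.sum_singleton, h']
      exact (smul_ne_zero_iff.1 hI).2
    have hdeg : 0 < p.degree := by
      rw [← Polynomial.natDegree_pos_iff_degree_pos]
      exact (Finset.card_pos.2 ⟨j, hjT⟩).trans_le (Polynomial.le_natDegree_of_ne_zero htop)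
    have hone := Polynomial.coeff_one_ne_zero_of_eval_ne_zero hdeg fun s hs => by
      rw [heval]
      exact ih (add_smul_mem_siegelUpperHalfSpace hZ (hP j).posSemidef hs)
    rw [hcoeff, Finset.powersetCard_one, Finset.sum_map, Finset.sum_congr rfl fun i hi => ?_,
      Finset.sum_const] at hone
    · exact (smul_ne_zero_iff.1 hone).2
    · have hi' : i ∉ T := Finset.mem_compl.1 hi
      rw [← polarizedDet_comp_perm ((insert j T).piecewise Q fun _ => Z) (Equiv.swap i j)]
      congr 1
      ext1 k
      rcases eq_or_ne k i with rfl | hki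
      · simp
      · rcases eq_or_ne k j with rfl | hkj
        · simp [hki, hj, hi', hki.symm]
        · by_cases hk : k ∈ T <;> simp [Equiv.swap_apply_of_ne_of_ne, hki, hkj, hk]

end Stability

section Form

variable {n : ℕ}

lemma polarizedDet_cons_cons_comm {R : Type*} [CommRing R]
    (P : Fin n → Matrix (Fin (n + 2)) (Fin (n + 2)) R)
    (A B : Matrix (Fin (n + 2)) (Fin (n + 2)) R) :
    polarizedDet R (Fin (n + 2)) (Fin.cons A (Fin.cons B P)) =
      polarizedDet R (Fin (n + 2)) (Fin.cons B (Fin.cons A P)) := by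
  rw [← polarizedDet_comp_perm (Fin.cons B _) (Equiv.swap 0 1)]
  congr 1
  ext1 k
  refine Fin.cases ?_ (fun k => Fin.cases ?_ (fun k => ?_) k) k
  · simp [Fin.cons_one]
  · simp [Fin.cons_one]
  · rw [Function.comp_apply, Equiv.swap_apply_of_ne_of_ne (by simp) (Fin.succ_succ_ne_one k)]
    simp

/-- The mixed discriminant as a bilinear form in its first two arguments. -/
noncomputable def polarizedDetForm {R : Type*} [CommRing R]
    (P : Fin n → Matrix (Fin (n + 2)) (Fin (n + 2)) R) :
    LinearMap.BilinForm R (Matrix (Fin (n + 2)) (Fin (n + 2)) R) :=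
  LinearMap.mk₂ R (fun A B => polarizedDet R (Fin (n + 2)) (Fin.cons A (Fin.cons B P)))
    (fun A A' B => MultilinearMap.cons_add _ _ _ _)
    (fun c A B => MultilinearMap.cons_smul _ _ _ _)
    (fun A B B' => by
      simp only [polarizedDet_cons_cons_comm P A]
      exact MultilinearMap.cons_add _ _ _ _)
    (fun c A B => by
      simp only [polarizedDet_cons_cons_comm P A]
      exact MultilinearMap.cons_smul _ _ _ _)

lemma polarizedDetForm_apply {R : Type*} [CommRing R]
    (P : Fin n → Matrix (Fin (n + 2)) (Fin (n + 2)) R)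
    (A B : Matrix (Fin (n + 2)) (Fin (n + 2)) R) :
    polarizedDetForm P A B = polarizedDet R (Fin (n + 2)) (Fin.cons A (Fin.cons B P)) := rfl

lemma polarizedDetForm_comm {R : Type*} [CommRing R]
    (P : Fin n → Matrix (Fin (n + 2)) (Fin (n + 2)) R)
    (A B : Matrix (Fin (n + 2)) (Fin (n + 2)) R) :
    polarizedDetForm P A B = polarizedDetForm P B A :=
  polarizedDet_cons_cons_comm P A B

lemma mixedDiscriminant_cons_cons (P : Fin n → Matrix (Fin (n + 2)) (Fin (n + 2)) ℝ)
    (A B : Matrix (Fin (n + 2)) (Fin (n + 2)) ℝ) :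
    mixedDiscriminant (Fin.cons A (Fin.cons B P)) = polarizedDetForm P A B := by
  rw [polarizedDetForm_apply, polarizedDet_eq_sum_det, mixedDiscriminant, Fintype.card_fin]

lemma polarizedDetForm_map {R S : Type*} [CommRing R] [CommRing S] (f : R →+* S)
    (P : Fin n → Matrix (Fin (n + 2)) (Fin (n + 2)) R)
    (A B : Matrix (Fin (n + 2)) (Fin (n + 2)) R) :
    polarizedDetForm (fun i => (P i).map f) (A.map f) (B.map f) = f (polarizedDetForm P A B) := by
  rw [polarizedDetForm_apply, polarizedDetForm_apply, ← polarizedDet_map]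
  congr 1
  ext1 k
  refine Fin.cases ?_ (fun k => Fin.cases ?_ (fun k => ?_) k) k <;> simp

variable {P : Fin n → Matrix (Fin (n + 2)) (Fin (n + 2)) ℝ}
  {A B : Matrix (Fin (n + 2)) (Fin (n + 2)) ℝ}

lemma polarizedDetForm_nonneg (hP : ∀ i, (P i).PosSemidef) (hA : A.PosSemidef)
    (hB : B.PosSemidef) : 0 ≤ polarizedDetForm P A B :=
  polarizedDet_nonneg <| Fin.cases (by simpa) <| Fin.cases (by simpa) (by simpa)

lemma polarizedDetForm_self_ne_zero (hP : ∀ i, (P i).PosDef)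
    {Z : Matrix (Fin (n + 2)) (Fin (n + 2)) ℂ} (hZ : Z ∈ siegelUpperHalfSpace (Fin (n + 2))) :
    polarizedDetForm (fun i => (P i).map Complex.ofRealHom) Z Z ≠ 0 := by
  have hP' : ∀ i, ((Fin.cons 1 (Fin.cons 1 P) : Fin (n + 2) → Matrix _ _ ℝ) i).PosDef :=
    Fin.cases (by simpa using PosDef.one) <| Fin.cases (by simpa using PosDef.one) (by simpa)
  convert polarizedDet_piecewise_ne_zero hP' {0, 1}ᶜ hZ using 1
  rw [polarizedDetForm_apply]
  congr 1
  ext1 k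
  refine Fin.cases ?_ (fun k => Fin.cases ?_ (fun k => ?_) k) k
  · simp
  · simp
  · rw [Finset.piecewise_eq_of_mem _ _ _ (by simp [Fin.succ_succ_ne_one])]
    simp

/-- **Alexandrov's inequality**, with one matrix the identity and the others positive definite. -/
lemma polarizedDetForm_mul_le_sq_of_posDef (hP : ∀ i, (P i).PosDef) (hA : A.IsSymm) :
    polarizedDetForm P A A * polarizedDetForm P 1 1 ≤ polarizedDetForm P A 1 ^ 2 := by
  have hc0 : 0 ≤ polarizedDetForm P 1 1 :=
    polarizedDetForm_nonneg (fun i => (hP i).posSemidef) PosSemidef.one PosSemidef.one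
  set a := polarizedDetForm P A A with ha
  set b := polarizedDetForm P A 1 with hb
  set c := polarizedDetForm P 1 1 with hc
  by_contra! h
  have hcpos : 0 < c := hc0.lt_of_ne' fun h0 => by
    rw [h0] at h
    nlinarith [sq_nonneg b]
  set r := √(a * c - b ^ 2) with hr
  have hrpos : 0 < r := Real.sqrt_pos.2 (by linarith)
  have hrsq : r ^ 2 = a * c - b ^ 2 := Real.sq_sqrt (by linarith)
  have hZ : A.map Complex.ofRealHom +
      ((-b / c : ℝ) + (r / c : ℝ) * Complex.I) •
        (1 : Matrix (Fin (n + 2)) (Fin (n + 2)) ℝ).map Complex.ofRealHom ∈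
      siegelUpperHalfSpace (Fin (n + 2)) := by
    refine ⟨A + (-b / c) • 1, (r / c) • 1, hA.add (isSymm_one.smul _),
      PosDef.one.smul (by positivity), ?_⟩
    rw [Matrix.map_one _ (map_zero _) (map_one _)]
    ext i j
    by_cases hij : i = j <;> apply Complex.ext <;> simp [hij]
  apply polarizedDetForm_self_ne_zero hP hZ
  simp only [map_add, map_smul, LinearMap.add_apply, LinearMap.smul_apply, polarizedDetForm_map,
    polarizedDetForm_comm P 1 A, ← ha, ← hb, ← hc, smul_eq_mul, Complex.ofRealHom_eq_coe]
  have hcc : (c : ℂ) ≠ 0 := by exact_mod_cast hcpos.ne'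
  have hrsq' : (r : ℂ) ^ 2 = a * c - b ^ 2 := by exact_mod_cast hrsq
  push_cast
  field_simp
  ring_nf
  simp only [Complex.I_sq, hrsq']
  ring

/-- **Alexandrov's inequality**, with one matrix the identity. -/
lemma polarizedDetForm_mul_le_sq (hP : ∀ i, (P i).PosSemidef) (hA : A.IsSymm) :
    polarizedDetForm P A A * polarizedDetForm P 1 1 ≤ polarizedDetForm P A 1 ^ 2 := by
  have hcont : ∀ A B : Matrix (Fin (n + 2)) (Fin (n + 2)) ℝ,
      Continuous fun ε : ℝ => polarizedDetForm (fun i => P i + ε • 1) A B := by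
    intro A B
    simp only [← mixedDiscriminant_cons_cons, mixedDiscriminant]
    refine continuous_finsetSum _ fun S _ => continuous_const.mul (Continuous.matrix_det ?_)
    refine continuous_finsetSum _ fun i _ => ?_
    refine Fin.cases ?_ (fun k => Fin.cases ?_ (fun k => ?_) k) i <;>
      simp only [Fin.cons_zero, Fin.cons_succ] <;> fun_prop
  have hlim : ∀ A B : Matrix (Fin (n + 2)) (Fin (n + 2)) ℝ, Filter.Tendsto
      (fun ε : ℝ => polarizedDetForm (fun i => P i + ε • 1) A B) (nhdsWithin 0 (Set.Ioi 0))
      (nhds (polarizedDetForm P A B)) := by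
    intro A B
    have := ((hcont A B).tendsto 0).mono_left (nhdsWithin_le_nhds (s := Set.Ioi 0))
    simpa using this
  refine le_of_tendsto_of_tendsto ((hlim A A).mul (hlim 1 1)) ((hlim A 1).pow 2) ?_
  filter_upwards [self_mem_nhdsWithin] with ε hε
  exact polarizedDetForm_mul_le_sq_of_posDef
    (fun i => PosDef.posSemidef_add (hP i) (PosDef.one.smul hε)) hA

end Form

lemma Matrix.IsSymm.exists_posSemidef_smul_one_sub_add {ι : Type*} [Fintype ι] [DecidableEq ι]
    {A : Matrix ι ι ℝ} (hA : A.IsSymm) :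
    ∃ K : ℝ, (K • 1 - A).PosSemidef ∧ (K • 1 + A).PosSemidef := by
  have hH : A.IsHermitian := (conjTranspose_eq_transpose_of_trivial A).trans hA
  have key : ∀ x : ι → ℝ, |x ⬝ᵥ A *ᵥ x| ≤ (∑ i, ∑ j, |A i j|) * (x ⬝ᵥ x) := by
    intro x
    have hx : ∀ i, x i ^ 2 ≤ x ⬝ᵥ x := fun i => by
      rw [sq]
      exact Finset.single_le_sum (f := fun k => x k * x k) (fun k _ => mul_self_nonneg _)
        (Finset.mem_univ i)
    have hxx : ∀ i j, |x i * x j| ≤ x ⬝ᵥ x := fun i j =>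
      abs_le.2 ⟨by nlinarith [hx i, hx j, sq_nonneg (x i + x j)],
        by nlinarith [hx i, hx j, sq_nonneg (x i - x j)]⟩
    rw [dotProduct, Finset.sum_mul]
    refine (Finset.abs_sum_le_sum_abs _ _).trans (Finset.sum_le_sum fun i _ => ?_)
    rw [mulVec, dotProduct, Finset.mul_sum, Finset.sum_mul]
    refine (Finset.abs_sum_le_sum_abs _ _).trans (Finset.sum_le_sum fun j _ => ?_)
    rw [mul_left_comm, abs_mul]
    exact mul_le_mul_of_nonneg_left (hxx i j) (abs_nonneg _)
  refine ⟨∑ i, ∑ j, |A i j|, ?_, ?_⟩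
  · refine .of_dotProduct_mulVec_nonneg
      ((isHermitian_one.smul (IsSelfAdjoint.all _)).sub hH) fun x => ?_
    have := (abs_le.1 (key x)).2
    simp only [star_trivial, sub_mulVec, smul_mulVec, one_mulVec, dotProduct_sub, dotProduct_smul,
      smul_eq_mul]
    linarith
  · refine .of_dotProduct_mulVec_nonneg
      ((isHermitian_one.smul (IsSelfAdjoint.all _)).add hH) fun x => ?_
    have := (abs_le.1 (key x)).1
    simp only [star_trivial, add_mulVec, smul_mulVec, one_mulVec, dotProduct_add, dotProduct_smul,
      smul_eq_mul]
    linarith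

lemma polarizedDetForm_one_one_pos {n : ℕ} {P : Fin n → Matrix (Fin (n + 2)) (Fin (n + 2)) ℝ}
    (hP : ∀ i, (P i).PosSemidef) {A B : Matrix (Fin (n + 2)) (Fin (n + 2)) ℝ}
    (hA : A.IsSymm) (hB : B.IsSymm) (hAB : polarizedDetForm P A B ≠ 0) :
    0 < polarizedDetForm P 1 1 := by
  refine (polarizedDetForm_nonneg hP PosSemidef.one PosSemidef.one).lt_of_ne' fun h0 => hAB ?_
  have h1 : ∀ C : Matrix (Fin (n + 2)) (Fin (n + 2)) ℝ, C.IsSymm → polarizedDetForm P 1 C = 0 := by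
    intro C hC
    obtain ⟨K, hK₁, hK₂⟩ := hC.exists_posSemidef_smul_one_sub_add
    have h₁ := polarizedDetForm_nonneg hP PosSemidef.one hK₁
    have h₂ := polarizedDetForm_nonneg hP PosSemidef.one hK₂
    simp only [map_sub, map_add, map_smul, h0, smul_zero] at h₁ h₂
    linarith
  obtain ⟨K, -, hK⟩ := hA.exists_posSemidef_smul_one_sub_add
  obtain ⟨L, hL₁, hL₂⟩ := hB.exists_posSemidef_smul_one_sub_add
  have h₁ := polarizedDetForm_nonneg hP hK hL₁
  have h₂ := polarizedDetForm_nonneg hP hK hL₂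
  simp only [map_sub, map_add, map_smul, LinearMap.add_apply, LinearMap.smul_apply, h0, h1 B hB,
    polarizedDetForm_comm P A 1, h1 A hA, smul_zero, add_zero, zero_add, zero_sub] at h₁ h₂
  linarith

/-- if `d = n + 2 ≥ 2` and `P_1, …, P_{d-2}` are positive semidefinite real
symmetric `d × d` matrices, and the symmetric bilinear form
`HR(η₁, η₂) = D(η₁, η₂, P_1, …, P_{d-2})` on the space of real symmetric `d × d` matrices is
not identically zero, then the associated quadratic form is positive definite on some
one-dimensional subspace of the symmetric matrices, but on no two-dimensional subspace. -/
theorem mixedDiscriminant_hodgeRiemann (n : ℕ)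
    (P : Fin n → Matrix (Fin (n + 2)) (Fin (n + 2)) ℝ)
    (hPsymm : ∀ i, (P i).IsSymm) (hPpsd : ∀ i, (P i).PosSemidef)
    (HR : Matrix (Fin (n + 2)) (Fin (n + 2)) ℝ → Matrix (Fin (n + 2)) (Fin (n + 2)) ℝ → ℝ)
    (hHR : ∀ η₁ η₂, HR η₁ η₂ = mixedDiscriminant (Fin.cons η₁ (Fin.cons η₂ P)))
    (hnz : ∃ η₁ η₂ : Matrix (Fin (n + 2)) (Fin (n + 2)) ℝ,
      η₁.IsSymm ∧ η₂.IsSymm ∧ HR η₁ η₂ ≠ 0) :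
    (∃ W : Submodule ℝ (Matrix (Fin (n + 2)) (Fin (n + 2)) ℝ),
      (∀ A ∈ W, A.IsSymm) ∧ Module.finrank ℝ W = 1 ∧
      (∀ A ∈ W, A ≠ 0 → 0 < HR A A)) ∧
    ¬ (∃ W : Submodule ℝ (Matrix (Fin (n + 2)) (Fin (n + 2)) ℝ),
      (∀ A ∈ W, A.IsSymm) ∧ Module.finrank ℝ W = 2 ∧
      (∀ A ∈ W, A ≠ 0 → 0 < HR A A)) := by
  simp only [mixedDiscriminant_cons_cons] at hHR
  obtain ⟨η₁, η₂, hη₁, hη₂, hη⟩ := hnz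
  rw [hHR] at hη
  have hpos := polarizedDetForm_one_one_pos hPpsd hη₁ hη₂ hη
  refine ⟨⟨ℝ ∙ 1, ?_, finrank_span_singleton one_ne_zero, ?_⟩, ?_⟩
  · intro A hA
    obtain ⟨c, rfl⟩ := Submodule.mem_span_singleton.1 hA
    exact isSymm_one.smul c
  · intro A hA hA0
    obtain ⟨c, rfl⟩ := Submodule.mem_span_singleton.1 hA
    have hc : c ≠ 0 := fun h => hA0 (by rw [h, zero_smul])
    simp only [hHR, map_smul, LinearMap.smul_apply, smul_eq_mul]
    rw [← mul_assoc]
    exact mul_pos (mul_self_pos.2 hc) hpos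
  · rintro ⟨W, hWsymm, hW2, hWpos⟩
    have hker : (((polarizedDetForm P).flip 1).domRestrict W).ker ≠ ⊥ :=
      LinearMap.ker_ne_bot_of_finrank_lt (by rw [hW2, Module.finrank_self]; norm_num)
    obtain ⟨⟨A, hAW⟩, hA, hA0⟩ := Submodule.exists_mem_ne_zero_of_ne_bot hker
    have hA1 : polarizedDetForm P A 1 = 0 := by simpa using hA
    have hAA := hWpos A hAW (by simpa using hA0)
    have h := polarizedDetForm_mul_le_sq hPpsd (hWsymm A hAW)
    rw [hHR] at hAA
    rw [hA1] at h
    nlinarith [mul_pos hAA hpos]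
end

section
/- Let d ≥ 2 and let a_1, …, a_d ∈ ℝ^d be column vectors with nonnegative entries. Writing per(b_1, …, b_d) for the permanent of the d×d matrix whose columns are b_1, …, b_d, we have per(a_1, a_2, a_3, …, a_d)^2 ≥ per(a_1, a_1, a_3, …, a_d) · per(a_2, a_2, a_3, …, a_d). -/
open Matrix

/-- The `d × d` matrix whose `j`-th column is the vector `a j`. -/
def colMatrix {d : ℕ} (a : Fin d → Fin d → ℝ) : Matrix (Fin d) (Fin d) ℝ :=
  Matrix.of fun i j => a j i

open Polynomial Function

/-- The permanent of the square matrix with columns `v j`. -/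
def columnPermanent {ι R : Type*} [Fintype ι] [DecidableEq ι] [CommRing R] (v : ι → ι → R) : R :=
  (Matrix.of fun i j => v j i).permanent

section ColumnPermanent

variable {ι R S : Type*} [Fintype ι] [DecidableEq ι] [CommRing R] [CommRing S]

theorem columnPermanent_eq_sum (v : ι → ι → R) :
    columnPermanent v = ∑ σ : Equiv.Perm ι, ∏ j, v j (σ j) := rfl

theorem columnPermanent_comp_perm (σ : Equiv.Perm ι) (v : ι → ι → R) :
    columnPermanent (v ∘ σ) = columnPermanent v :=
  Matrix.permanent_permute_rows σ (Matrix.of fun i j => v j i)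

theorem map_columnPermanent (f : R →+* S) (v : ι → ι → R) :
    f (columnPermanent v) = columnPermanent fun j i => f (v j i) := by
  simp [columnPermanent_eq_sum]

theorem columnPermanent_update_eq (v : ι → ι → R) (j : ι) (x : ι → R) :
    columnPermanent (update v j x) =
      ∑ σ : Equiv.Perm ι, x (σ j) * ∏ k ∈ Finset.univ.erase j, v k (σ k) := by
  rw [columnPermanent_eq_sum]
  refine Finset.sum_congr rfl fun σ _ => ?_
  rw [← Finset.mul_prod_erase _ _ (Finset.mem_univ j), update_self]
  congr 1
  refine Finset.prod_congr rfl fun k hk => ?_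
  rw [update_of_ne (Finset.ne_of_mem_erase hk)]

theorem columnPermanent_update_add (v : ι → ι → R) (j : ι) (x y : ι → R) :
    columnPermanent (update v j (x + y)) =
      columnPermanent (update v j x) + columnPermanent (update v j y) := by
  simp [columnPermanent_update_eq, add_mul, Finset.sum_add_distrib]

theorem columnPermanent_update_smul (v : ι → ι → R) (j : ι) (c : R) (x : ι → R) :
    columnPermanent (update v j (c • x)) = c * columnPermanent (update v j x) := by
  simp [columnPermanent_update_eq, mul_assoc, Finset.mul_sum]

theorem columnPermanent_update_zero (v : ι → ι → R) (j : ι) :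
    columnPermanent (update v j 0) = 0 := by
  simp [columnPermanent_update_eq]

theorem columnPermanent_smul (c : ι → R) (v : ι → ι → R) :
    columnPermanent (fun j => c j • v j) = (∏ j, c j) * columnPermanent v := by
  simp [columnPermanent_eq_sum, Finset.prod_mul_distrib, Finset.mul_sum]

theorem columnPermanent_const (x : ι → R) :
    columnPermanent (fun _ => x) = (Fintype.card ι).factorial * ∏ i, x i := by
  simp [columnPermanent_eq_sum, Equiv.prod_comp, Fintype.card_perm]

theorem derivative_columnPermanent (v : ι → ι → R[X]) :
    derivative (columnPermanent v) =
      ∑ j, columnPermanent (update v j fun i => derivative (v j i)) := by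
  simp_rw [columnPermanent_update_eq]
  rw [Finset.sum_comm, columnPermanent_eq_sum, derivative_sum]
  refine Finset.sum_congr rfl fun σ _ => ?_
  rw [derivative_prod_finset]
  exact Finset.sum_congr rfl fun j _ => mul_comm _ _

theorem columnPermanent_pos {v : ι → ι → ℝ} (hv : ∀ j i, 0 < v j i) : 0 < columnPermanent v :=
  Finset.sum_pos (fun σ _ => Finset.prod_pos fun j _ => hv j (σ j)) Finset.univ_nonempty

theorem ofReal_columnPermanent (v : ι → ι → ℝ) :
    ((columnPermanent v : ℝ) : ℂ) = columnPermanent fun j i => (v j i : ℂ) :=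
  map_columnPermanent Complex.ofRealHom v

theorem continuous_columnPermanent {X : Type*} [TopologicalSpace X] [TopologicalSpace R]
    [IsTopologicalRing R] {v : X → ι → ι → R} (hv : ∀ j i, Continuous fun x => v x j i) :
    Continuous fun x => columnPermanent (v x) := by
  simp_rw [columnPermanent_eq_sum]
  exact continuous_finsetSum _ fun σ _ => continuous_finsetProd _ fun j _ => hv j (σ j)

end ColumnPermanent

section Stability

variable {ι : Type*} [Fintype ι] [DecidableEq ι]

/-- The permanent whose columns in `s` are those of the real matrix `a` and whose other columns
are all equal to `u`. -/
noncomputable def mixedPermanent (a : ι → ι → ℝ) (s : Finset ι) (u : ι → ℂ) : ℂ :=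
  columnPermanent fun j => if j ∈ s then fun i => (a j i : ℂ) else u

/-- The restriction of `mixedPermanent a s` to the line through `u` with direction `b`, as a
polynomial. -/
noncomputable def mixedPermanentLine (a : ι → ι → ℝ) (s : Finset ι) (u b : ι → ℂ) : ℂ[X] :=
  columnPermanent fun j => if j ∈ s then fun i => C (a j i : ℂ) else fun i => C (u i) + C (b i) * X

theorem eval_mixedPermanentLine (a : ι → ι → ℝ) (s : Finset ι) (u b : ι → ℂ) (t : ℂ) :
    (mixedPermanentLine a s u b).eval t = mixedPermanent a s (u + t • b) := by
  rw [mixedPermanentLine, mixedPermanent, ← coe_evalRingHom, map_columnPermanent]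
  congr 1
  ext j i
  split_ifs
  · simp
  · simp [mul_comm t]

theorem derivative_mixedPermanentLine (a : ι → ι → ℝ) {s : Finset ι} {k : ι} (hk : k ∉ s)
    (u : ι → ℂ) :
    derivative (mixedPermanentLine a s u fun i => a k i) =
      (sᶜ.card : ℂ[X]) * mixedPermanentLine a (insert k s) u fun i => a k i := by
  rw [mixedPermanentLine, derivative_columnPermanent, ← Finset.sum_compl_add_sum s,
    Finset.sum_eq_zero (s := s), add_zero, Finset.sum_eq_card_nsmul, nsmul_eq_mul]
  · intro j hj
    rw [Finset.mem_compl] at hj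
    rw [mixedPermanentLine, ← columnPermanent_comp_perm (Equiv.swap j k)]
    congr 1
    ext1 l
    rcases eq_or_ne l k with rfl | hlk
    · rcases eq_or_ne j l with rfl | hjl
      · simp [hj]
      · simp [hj, hk]
    · rcases eq_or_ne l j with rfl | hlj
      · simp [hj, hk, hlk, hlk.symm]
      · simp [Equiv.swap_apply_of_ne_of_ne, hlj, hlk]
  · intro j hj
    convert columnPermanent_update_zero _ j
    simp [hj]

theorem mixedPermanentLine_ne_zero {a : ι → ι → ℝ} (ha : ∀ j i, 0 < a j i) (s : Finset ι)
    (u : ι → ℂ) (k : ι) : mixedPermanentLine a s u (fun i => a k i) ≠ 0 := by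
  intro h
  let g : ℂ → ℂ := fun t => mixedPermanent a s (t • u + fun i => (a k i : ℂ))
  have hg : Continuous g := by
    refine continuous_columnPermanent fun j i => ?_
    by_cases hj : j ∈ s
    · simpa [hj] using continuous_const
    · simp only [hj, if_false, Pi.add_apply, Pi.smul_apply]
      fun_prop
  have hg0 : ∀ t ∈ ({0}ᶜ : Set ℂ), g t = 0 := by
    intro t ht
    have ht : t ≠ 0 := ht
    have h1 : mixedPermanent a s (u + t⁻¹ • fun i => (a k i : ℂ)) = 0 := by
      rw [← eval_mixedPermanentLine, h, eval_zero]
    have h2 : g t = (∏ j, if j ∈ s then 1 else t) *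
        mixedPermanent a s (u + t⁻¹ • fun i => (a k i : ℂ)) := by
      rw [mixedPermanent, ← columnPermanent_smul]
      refine congrArg columnPermanent ?_
      ext j i
      by_cases hj : j ∈ s
      · simp [hj]
      · simp only [hj, if_false, Pi.add_apply, Pi.smul_apply, smul_eq_mul]
        field_simp
    rw [h2, h1, mul_zero]
  have h0 : g 0 = 0 := by
    have := Continuous.ext_on (dense_compl_singleton (0 : ℂ)) hg continuous_const hg0
    exact congrFun this 0
  have hpos : 0 < columnPermanent fun j => if j ∈ s then a j else a k :=
    columnPermanent_pos fun j i => by split_ifs <;> exact ha _ _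
  refine hpos.ne' (Complex.ofReal_injective ?_)
  rw [ofReal_columnPermanent, Complex.ofReal_zero, ← h0]
  refine congrArg columnPermanent ?_
  ext j i
  by_cases hj : j ∈ s <;> simp [hj]

theorem mixedPermanent_ne_zero {a : ι → ι → ℝ} (ha : ∀ j i, 0 < a j i) (s : Finset ι)
    {u : ι → ℂ} (hu : ∀ i, 0 < (u i).im) : mixedPermanent a s u ≠ 0 := by
  induction s using Finset.induction_on generalizing u with
  | empty =>
    simp only [mixedPermanent, Finset.notMem_empty, if_false, columnPermanent_const]
    refine mul_ne_zero (Nat.cast_ne_zero.mpr (Nat.factorial_ne_zero _))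
      (Finset.prod_ne_zero_iff.mpr fun i _ hi => ?_)
    simpa [hi] using hu i
  | insert k s hk ih =>
    intro h0
    set q := mixedPermanentLine a s u fun i => a k i with hq
    have hd := derivative_mixedPermanentLine a hk u
    have hcard : (sᶜ.card : ℂ[X]) ≠ 0 :=
      Nat.cast_ne_zero.mpr (Finset.card_ne_zero_of_mem (Finset.mem_compl.mpr hk))
    have hq' : derivative q ≠ 0 := by
      rw [hd]
      exact mul_ne_zero hcard (mixedPermanentLine_ne_zero ha _ _ _)
    have hdeg : 0 < q.degree := by
      by_contra hle
      exact hq' (derivative_of_natDegree_zero (natDegree_eq_zero_iff_degree_le_zero.mpr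
        (not_lt.mp hle)))
    have hroot : (0 : ℂ) ∈ (derivative q).rootSet ℂ := by
      rw [mem_rootSet]
      refine ⟨hq', ?_⟩
      rw [coe_aeval_eq_eval, hd, eval_mul, eval_mixedPermanentLine, zero_smul, add_zero, h0, mul_zero]
    have hsub : q.rootSet ℂ ⊆ {z : ℂ | z.im < 0} := by
      intro t ht
      by_contra hneg
      have hneg : 0 ≤ t.im := not_lt.mp hneg
      have ht := (mem_rootSet.mp ht).2
      rw [coe_aeval_eq_eval, hq, eval_mixedPermanentLine] at ht
      refine ih (fun i => ?_) ht
      have := mul_nonneg hneg (ha k i).le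
      simpa using add_pos_of_pos_of_nonneg (hu i) this
    have := convexHull_min hsub (convex_halfSpace_im_lt 0)
      (rootSet_derivative_subset_convexHull_rootSet hdeg hroot)
    simp at this

/-- The Alexandrov–Fenchel inequality for permanents of matrices with positive entries. -/
theorem columnPermanent_update_mul_le_sq_of_pos {a : ι → ι → ℝ} (ha : ∀ j i, 0 < a j i)
    {k l : ι} (hkl : k ≠ l) :
    columnPermanent (update a l (a k)) * columnPermanent (update a k (a l)) ≤
      columnPermanent a ^ 2 := by
  set A := columnPermanent (update a l (a k)) with hA
  set B := columnPermanent a with hB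
  set D := columnPermanent (update a k (a l)) with hD
  by_contra! hlt
  have hApos : 0 < A := columnPermanent_pos fun j i => by
    rcases eq_or_ne j l with rfl | hj <;> simp [*]
  set r := √(A * D - B ^ 2) with hr
  have hrsq : r ^ 2 = A * D - B ^ 2 := Real.sq_sqrt (by linarith)
  have hrpos : 0 < r := Real.sqrt_pos.mpr (by linarith)
  set z : ℂ := ⟨-B / A, r / A⟩ with hz
  have hquad : (A : ℂ) * z ^ 2 + 2 * B * z + D = 0 := by
    have hre : A * (-B / A * (-B / A) - r / A * (r / A)) + 2 * B * (-B / A) + D = 0 := by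
      field_simp
      linarith
    apply Complex.ext
    · simpa [hz, pow_two] using hre
    · simp [hz, pow_two]
      field_simp
      ring
  let c : ι → ι → ℂ := fun j i => a j i
  have hu : ∀ i, 0 < ((z • c k + c l) i).im := fun i => by
    simpa [c, hz] using mul_pos (div_pos hrpos hApos) (ha k i)
  refine mixedPermanent_ne_zero ha {k, l}ᶜ hu ?_
  have hmixed : mixedPermanent a {k, l}ᶜ (z • c k + c l) =
      columnPermanent (update (update c k (z • c k + c l)) l (z • c k + c l)) := by
    refine congrArg columnPermanent ?_
    ext1 j
    rcases eq_or_ne j k with rfl | hjk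
    · simp [hkl]
    · rcases eq_or_ne j l with rfl | hjl
      · simp
      · simp [hjk, hjl, c]
  have hcA : columnPermanent (update c l (c k)) = A := by
    rw [hA, ofReal_columnPermanent]
    refine congrArg columnPermanent ?_
    ext j i
    rcases eq_or_ne j l with rfl | hj <;> simp [*, c]
  have hcD : columnPermanent (update c k (c l)) = D := by
    rw [hD, ofReal_columnPermanent]
    refine congrArg columnPermanent ?_
    ext j i
    rcases eq_or_ne j k with rfl | hj <;> simp [*, c]
  have hcB : columnPermanent c = B := (ofReal_columnPermanent a).symm
  have hswap : columnPermanent (update (update c l (c k)) k (c l)) = B := by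
    rw [← hcB, ← columnPermanent_comp_perm (Equiv.swap k l) c]
    refine congrArg columnPermanent ?_
    ext1 j
    rcases eq_or_ne j k with rfl | hjk
    · simp
    · rcases eq_or_ne j l with rfl | hjl
      · simp [hjk]
      · simp [hjk, hjl, Equiv.swap_apply_of_ne_of_ne]
  have hself : update (update c l (c k)) k (c k) = update c l (c k) := by
    rw [update_comm hkl.symm, update_eq_self]
  rw [hmixed, columnPermanent_update_add, columnPermanent_update_smul]
  simp_rw [update_comm hkl]
  rw [columnPermanent_update_add, columnPermanent_update_smul, columnPermanent_update_add,
    columnPermanent_update_smul, hswap, update_eq_self l c, update_eq_self k c, hcB, hcD,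
    hself, hcA, ← hquad]
  ring

/-- The Alexandrov–Fenchel inequality for permanents of matrices with nonnegative entries. -/
theorem columnPermanent_update_mul_le_sq {a : ι → ι → ℝ} (ha : ∀ j i, 0 ≤ a j i)
    {k l : ι} (hkl : k ≠ l) :
    columnPermanent (update a l (a k)) * columnPermanent (update a k (a l)) ≤
      columnPermanent a ^ 2 := by
  let b : ℝ → ι → ι → ℝ := fun ε j i => a j i + ε
  have hb : Continuous b := by fun_prop
  have hcont {v : ℝ → ι → ι → ℝ} (hv : Continuous v) :
      Continuous fun ε => columnPermanent (v ε) :=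
    continuous_columnPermanent fun j i => by fun_prop
  have hbj (j : ι) : Continuous fun ε => b ε j := by fun_prop
  have hleft : Continuous fun ε => columnPermanent (update (b ε) l (b ε k)) *
      columnPermanent (update (b ε) k (b ε l)) :=
    (hcont (hb.update l (hbj k))).mul (hcont (hb.update k (hbj l)))
  have hmem : (0 : ℝ) ∈ closure (Set.Ioi 0) := by simp
  have := closure_minimal (t := {ε | columnPermanent (update (b ε) l (b ε k)) *
      columnPermanent (update (b ε) k (b ε l)) ≤ columnPermanent (b ε) ^ 2})
    (fun ε (hε : 0 < ε) => columnPermanent_update_mul_le_sq_of_pos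
      (fun j i => add_pos_of_nonneg_of_pos (ha j i) hε) hkl)
    (isClosed_le hleft ((hcont hb).pow 2)) hmem
  simpa [b] using this

end Stability

/-- for `d = n + 2 ≥ 2` column vectors `a_1, …, a_d ∈ ℝ^d` with nonnegative
entries, `per(a_1, a_2, a_3, …, a_d)^2 ≥ per(a_1, a_1, a_3, …, a_d) ⬝ per(a_2, a_2, a_3, …, a_d)`. -/
theorem permanent_alexandrov_fenchel (n : ℕ) (a : Fin (n + 2) → Fin (n + 2) → ℝ)
    (ha : ∀ j i, 0 ≤ a j i) :
    (colMatrix a).permanent ^ 2 ≥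
      (colMatrix (Function.update a 1 (a 0))).permanent *
        (colMatrix (Function.update a 0 (a 1))).permanent := by
  exact columnPermanent_update_mul_le_sq ha (by simp)
end

section
/- Let d ≥ 1 and let A be a doubly stochastic d×d real matrix, i.e., all entries of A are nonnegative and every row sum and every column sum of A equals 1. Then per(A) ≥ d!/d^d. -/
open Matrix

/-!
We follow Gurvits's capacity argument, applied to the product of all variables and its iterated
directional derivatives along the (strictly positive) columns of a matrix.
-/

section PositiveStable

open MvPolynomial

variable {ι : Type*}

/-- The directional derivative of a real polynomial along `u`. -/
noncomputable def dirDeriv (u : ι → ℝ) :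
    Derivation ℝ (MvPolynomial ι ℝ) (MvPolynomial ι ℝ) :=
  mkDerivation ℝ fun i => C (u i)

/-- Iterated directional derivative along the vectors of a finite family. -/
noncomputable def iterDirDeriv :
    ∀ {k : ℕ}, (Fin k → ι → ℝ) → MvPolynomial ι ℝ →ₗ[ℝ] MvPolynomial ι ℝ
  | 0, _ => LinearMap.id
  | _ + 1, a => iterDirDeriv (fun j => a j.succ) ∘ₗ (dirDeriv (a 0)).toLinearMap

/-- The restriction of a real polynomial to the line `t ↦ z + t • w`, over an extension of `ℝ`. -/
noncomputable def lineRestrict {K : Type*} [Field K] [Algebra ℝ K] (P : MvPolynomial ι ℝ)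
    (z w : ι → K) : Polynomial K :=
  aeval (fun i => Polynomial.C (z i) + Polynomial.C (w i) * Polynomial.X) P

section Line

variable {K : Type*} [Field K] [Algebra ℝ K]

lemma eval_lineRestrict (P : MvPolynomial ι ℝ) (z w : ι → K) (t : K) :
    (lineRestrict P z w).eval t = aeval (fun i => z i + w i * t) P := by
  unfold lineRestrict
  induction P using MvPolynomial.induction_on with
  | C a => simp [Polynomial.algebraMap_apply]
  | add p q hp hq => simp [hp, hq]
  | mul_X p i hp => simp [hp]

lemma derivative_lineRestrict (P : MvPolynomial ι ℝ) (z : ι → K) (u : ι → ℝ) :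
    Polynomial.derivative (lineRestrict P z fun i => algebraMap ℝ K (u i)) =
      lineRestrict (dirDeriv u P) z fun i => algebraMap ℝ K (u i) := by
  unfold lineRestrict dirDeriv
  induction P using MvPolynomial.induction_on with
  | C a => simp [Polynomial.algebraMap_apply]
  | add p q hp hq => simp [hp, hq]
  | mul_X p i hp =>
    simp [hp, mkDerivation_X, Polynomial.algebraMap_apply, Derivation.leibniz]
    ring

lemma natDegree_lineRestrict_le {P : MvPolynomial ι ℝ} {k : ℕ} (hP : P.IsHomogeneous k)
    (z w : ι → K) : (lineRestrict P z w).natDegree ≤ k := by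
  unfold lineRestrict
  rw [aeval_def, eval₂_eq]
  refine Polynomial.natDegree_sum_le_of_forall_le _ _ fun d hd => ?_
  rw [Polynomial.algebraMap_apply]
  refine (Polynomial.natDegree_C_mul_le _ _).trans ?_
  refine (Polynomial.natDegree_prod_le _ _).trans ?_
  rw [hP.degree_eq_sum_deg_support hd]
  refine Finset.sum_le_sum fun i _ => ?_
  refine (Polynomial.natDegree_pow_le_of_le (m := 1) (d i) ?_).trans (by simp)
  compute_degree

lemma aeval_mul_of_isHomogeneous {P : MvPolynomial ι ℝ} {k : ℕ}
    (hP : P.IsHomogeneous k) (c : K) (z : ι → K) :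
    aeval (fun i => c * z i) P = c ^ k * aeval z P := by
  rw [aeval_def, aeval_def, eval₂_eq, eval₂_eq, Finset.mul_sum]
  refine Finset.sum_congr rfl fun d hd => ?_
  rw [hP.degree_eq_sum_deg_support hd]
  simp only [mul_pow, Finset.prod_mul_distrib, Finset.prod_pow_eq_pow_sum]
  ring

lemma dirDeriv_isHomogeneous [Fintype ι] {P : MvPolynomial ι ℝ} {k : ℕ}
    (hP : P.IsHomogeneous (k + 1)) (u : ι → ℝ) : (dirDeriv u P).IsHomogeneous k := by
  have h : dirDeriv u = ∑ i, u i • pderiv (R := ℝ) i := by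
    classical
    refine derivation_ext fun j => ?_
    rw [dirDeriv, mkDerivation_X, ← Derivation.coeFnAddMonoidHom_apply, map_sum,
      Finset.sum_apply]
    simp [pderiv_X, Pi.single_apply, smul_eq_C_mul]
  rw [h, ← Derivation.coeFnAddMonoidHom_apply, map_sum, Finset.sum_apply]
  refine IsHomogeneous.sum _ _ _ fun i _ => ?_
  simpa [smul_eq_C_mul] using (hP.pderiv (i := i)).C_mul (u i)

lemma natDegree_lineRestrict_ne_zero [CharZero K] {P : MvPolynomial ι ℝ} {k : ℕ}
    (hP : P.IsHomogeneous (k + 1)) (z w : ι → K) (hw : aeval w P ≠ 0) :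
    (lineRestrict P z w).natDegree ≠ 0 := by
  intro h
  obtain ⟨c, hc⟩ := Polynomial.natDegree_eq_zero.mp h
  have key : lineRestrict P w z = Polynomial.C c * Polynomial.X ^ (k + 1) := by
    refine Polynomial.eq_of_infinite_eval_eq _ _
      ((Set.finite_singleton (0 : K)).infinite_compl.mono fun t ht => ?_)
    have ht : t ≠ 0 := ht
    have h1 : (lineRestrict P z w).eval t⁻¹ = c := by rw [← hc]; simp
    rw [eval_lineRestrict] at h1
    change (lineRestrict P w z).eval t = _
    rw [eval_lineRestrict, ← h1]
    simp only [Polynomial.eval_mul, Polynomial.eval_C, Polynomial.eval_pow, Polynomial.eval_X]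
    rw [mul_comm, ← aeval_mul_of_isHomogeneous hP]
    congr 1
    congr 1
    funext i
    field_simp
    ring
  apply hw
  have := congrArg (Polynomial.eval 0) key
  rw [eval_lineRestrict] at this
  simpa using this

end Line

lemma Multiset.prod_one_add_mul_le (s : Multiset ℝ) (hs : ∀ a ∈ s, 0 ≤ a) {k : ℕ} (hk : k ≠ 0)
    (hcard : s.card ≤ k) {t : ℝ} (ht : 0 ≤ t) :
    (s.map fun a => 1 + t * a).prod ≤ (1 + t * s.sum / k) ^ k := by
  have hk' : (0 : ℝ) < k := by exact_mod_cast Nat.pos_of_ne_zero hk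
  have hS : 0 ≤ s.sum := Multiset.sum_nonneg hs
  set M : ℝ := 1 + t * s.sum / k with hM
  have hM0 : 0 < M := by positivity
  set E : ℝ := M * Real.exp (-(1 - M⁻¹)) with hE
  have hE1 : 1 ≤ E := by
    have h1 := Real.exp_le_exp.mpr (Real.one_sub_inv_le_log_of_pos hM0)
    rw [Real.exp_log hM0] at h1
    rw [hE, Real.exp_neg, ← div_eq_mul_inv, one_le_div (Real.exp_pos _)]
    exact h1
  have key : ∀ s : Multiset ℝ, (∀ a ∈ s, 0 ≤ a) →
      (s.map fun a => 1 + t * a).prod ≤ E ^ s.card * Real.exp (t * s.sum / M) := by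
    intro s
    induction s using Multiset.induction_on with
    | empty => simp
    | cons a s ih =>
      intro hs
      rw [Multiset.map_cons, Multiset.prod_cons, Multiset.card_cons, Multiset.sum_cons]
      have ha : 1 + t * a ≤ E * Real.exp (t * a / M) := by
        have h1 := Real.add_one_le_exp ((1 + t * a) / M - 1)
        rw [sub_add_cancel, div_le_iff₀ hM0] at h1
        refine h1.trans (le_of_eq ?_)
        rw [hE, mul_assoc, ← Real.exp_add, mul_comm]
        congr 2
        field_simp
        ring
      have hs' : ∀ b ∈ s, 0 ≤ b := fun b hb => hs b (Multiset.mem_cons_of_mem hb)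
      have ha0 : 0 ≤ a := hs a (Multiset.mem_cons_self a s)
      refine (mul_le_mul ha (ih hs') ?_ (by positivity)).trans (le_of_eq ?_)
      · refine Multiset.prod_nonneg fun b hb => ?_
        obtain ⟨c, hc, rfl⟩ := Multiset.mem_map.mp hb
        have := hs' c hc
        positivity
      · rw [mul_add, add_div, Real.exp_add, pow_succ]
        ring
  calc (s.map fun a => 1 + t * a).prod ≤ E ^ s.card * Real.exp (t * s.sum / M) := key s hs
    _ ≤ E ^ k * Real.exp (t * s.sum / M) := by gcongr
    _ = M ^ k := by
      rw [hE, mul_pow, ← Real.exp_nat_mul, mul_assoc, ← Real.exp_add]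
      have : (k : ℝ) * -(1 - M⁻¹) + t * s.sum / M = 0 := by
        have h1 : t * s.sum = k * (M - 1) := by rw [hM]; field_simp; ring
        rw [h1]
        field_simp
        ring
      rw [this, Real.exp_zero, mul_one]

/-- A homogeneous real polynomial which is positive on the open positive orthant and does not
vanish when all variables lie in the open upper half plane. -/
structure PosStable (P : MvPolynomial ι ℝ) (k : ℕ) : Prop where
  isHomogeneous : P.IsHomogeneous k
  eval_pos : ∀ x : ι → ℝ, (∀ i, 0 < x i) → 0 < eval x P
  aeval_ne_zero : ∀ z : ι → ℂ, (∀ i, 0 < (z i).im) → aeval z P ≠ 0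

lemma aeval_ofReal (P : MvPolynomial ι ℝ) (x : ι → ℝ) :
    aeval (fun i => (x i : ℂ)) P = (eval x P : ℂ) := by
  have := aeval_algebraMap_apply (A := ℝ) ℂ x P
  simpa [aeval_eq_eval, Function.comp_def] using this

lemma aeval_conj (P : MvPolynomial ι ℝ) (z : ι → ℂ) :
    aeval (fun i => starRingEnd ℂ (z i)) P = starRingEnd ℂ (aeval z P) := by
  induction P using MvPolynomial.induction_on with
  | C a => simp
  | add p q hp hq => simp [hp, hq]
  | mul_X p i hp => simp [hp]

lemma posStable_prod_X [Fintype ι] : PosStable (∏ i : ι, X i : MvPolynomial ι ℝ)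
    (Fintype.card ι) where
  isHomogeneous := by
    simpa using IsHomogeneous.prod Finset.univ (fun i : ι => (X i : MvPolynomial ι ℝ))
      (fun _ => 1) fun i _ => isHomogeneous_X ℝ i
  eval_pos x hx := by
    rw [map_prod]
    exact Finset.prod_pos fun i _ => by simpa using hx i
  aeval_ne_zero z hz := by
    rw [map_prod, Finset.prod_ne_zero_iff]
    intro i _ h
    have := hz i
    simp_all

namespace PosStable

variable {P : MvPolynomial ι ℝ} {k : ℕ} {u v : ι → ℝ}

lemma isRoot_lineRestrict (hP : PosStable P k) (hv : ∀ i, 0 < v i) (hu : ∀ i, 0 < u i) {r : ℂ}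
    (hr : (lineRestrict P (fun i => (v i : ℂ)) fun i => (u i : ℂ)).IsRoot r) :
    r.im = 0 ∧ r.re < 0 := by
  rw [Polynomial.IsRoot, eval_lineRestrict] at hr
  have him : r.im = 0 := by
    rcases lt_trichotomy r.im 0 with h | h | h
    · refine absurd ?_ (hP.aeval_ne_zero (fun i => starRingEnd ℂ (v i + u i * r)) fun i => ?_)
      · rw [aeval_conj, hr, map_zero]
      · simpa using mul_neg_of_pos_of_neg (hu i) h
    · exact h
    · exact absurd hr (hP.aeval_ne_zero _ fun i => by simpa using mul_pos (hu i) h)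
  refine ⟨him, ?_⟩
  by_contra! h
  have hr' : r = (r.re : ℂ) := Complex.ext (by simp) (by simpa using him)
  have h2 := hP.eval_pos (fun i => v i + u i * r.re) fun i =>
    add_pos_of_pos_of_nonneg (hv i) (mul_nonneg (hu i).le h)
  rw [hr'] at hr
  have h3 := aeval_ofReal P fun i => v i + u i * r.re
  push_cast at h3
  rw [h3] at hr
  exact h2.ne' (by exact_mod_cast hr)

/-- The restriction of `P` to a positive line factors into `card s ≤ k` linear factors. -/
lemma exists_linear_factors (hP : PosStable P k) (hv : ∀ i, 0 < v i) (hu : ∀ i, 0 < u i) :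
    ∃ s : Multiset ℝ, (∀ a ∈ s, 0 < a) ∧ s.card ≤ k ∧
      (k ≠ 0 → s ≠ 0) ∧
      (∀ t : ℝ, eval (fun i => v i + u i * t) P =
        eval v P * (s.map fun a => 1 + t * a).prod) ∧
      eval v (dirDeriv u P) = eval v P * s.sum := by
  set L := lineRestrict P (fun i => (v i : ℂ)) fun i => (u i : ℂ) with hL
  have hsp : L.Splits := IsAlgClosed.splits L
  have hvP := hP.eval_pos v hv
  have hL0 : L.eval 0 = (eval v P : ℂ) := by
    rw [hL, eval_lineRestrict, ← aeval_ofReal]; simp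
  have hL0' : L.eval 0 ≠ 0 := by rw [hL0]; exact_mod_cast hvP.ne'
  have hLne : L ≠ 0 := by rintro h; simp [h] at hL0'
  have hroot : ∀ r ∈ L.roots, r.im = 0 ∧ r.re < 0 := fun r hr =>
    hP.isRoot_lineRestrict hv hu ((Polynomial.mem_roots hLne).mp hr)
  have hcast : ∀ r ∈ L.roots, (((-r.re)⁻¹ : ℝ) : ℂ) = 1 / (0 - r) := fun r hr => by
    have hr' : r = (r.re : ℂ) := Complex.ext (by simp) (by simpa using (hroot r hr).1)
    conv_rhs => rw [hr']
    push_cast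
    simp
  refine ⟨L.roots.map fun r => (-r.re)⁻¹, ?_, ?_, ?_, ?_, ?_⟩
  · intro a ha
    obtain ⟨r, hr, rfl⟩ := Multiset.mem_map.mp ha
    have := (hroot r hr).2
    exact inv_pos.mpr (by linarith)
  · rw [Multiset.card_map]
    exact (Polynomial.card_roots' L).trans (natDegree_lineRestrict_le hP.isHomogeneous _ _)
  · intro hk h
    obtain ⟨m, rfl⟩ := Nat.exists_eq_succ_of_ne_zero hk
    have h1 := hsp.natDegree_eq_card_roots
    rw [Multiset.map_eq_zero] at h
    rw [h] at h1
    refine natDegree_lineRestrict_ne_zero hP.isHomogeneous _ _ ?_ h1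
    rw [aeval_ofReal]
    exact_mod_cast (hP.eval_pos u hu).ne'
  · intro t
    have h1 : (eval (fun i => v i + u i * t) P : ℂ) = L.eval (t : ℂ) := by
      rw [hL, eval_lineRestrict, ← aeval_ofReal]; simp
    apply Complex.ofReal_injective
    rw [h1, Complex.ofReal_mul, ← hL0, hsp.eval_eq_prod_roots, hsp.eval_eq_prod_roots, mul_assoc]
    congr 1
    rw [Multiset.map_map, ← Complex.ofRealHom_eq_coe (Multiset.prod _), map_multiset_prod,
      Multiset.map_map, ← Multiset.prod_map_mul]
    congr 1
    refine Multiset.map_congr rfl fun r hr => ?_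
    have h0 : (0 : ℂ) - r ≠ 0 := by
      intro h
      have := (hroot r hr).2
      rw [zero_sub, neg_eq_zero] at h
      simp [h] at this
    simp only [Function.comp, Complex.ofRealHom_eq_coe, Complex.ofReal_add, Complex.ofReal_mul,
      Complex.ofReal_one, hcast r hr]
    field_simp
    ring
  · have h1 := hsp.eval_derivative_eq_eval_mul_sum hL0'
    have h2 : L.derivative.eval 0 = (eval v (dirDeriv u P) : ℂ) := by
      rw [hL]
      have := derivative_lineRestrict (K := ℂ) P (fun i => (v i : ℂ)) u
      simp only [Complex.coe_algebraMap] at this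
      rw [this, eval_lineRestrict, ← aeval_ofReal]; simp
    apply Complex.ofReal_injective
    push_cast
    rw [← h2, h1, hL0]
    congr 1
    rw [← Complex.ofRealHom_eq_coe, map_multiset_sum, Multiset.map_map]
    congr 1
    exact Multiset.map_congr rfl fun r hr => (hcast r hr).symm

/-- Positive directional derivatives preserve positive stability. -/
lemma dirDeriv [Fintype ι] (hP : PosStable P (k + 1)) (hu : ∀ i, 0 < u i) :
    PosStable (dirDeriv u P) k where
  isHomogeneous := dirDeriv_isHomogeneous hP.isHomogeneous u
  eval_pos x hx := by
    obtain ⟨s, hs, -, hne, -, h⟩ := hP.exists_linear_factors hx hu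
    rw [h]
    refine mul_pos (hP.eval_pos x hx) ?_
    obtain ⟨a, ha⟩ := Multiset.exists_mem_of_ne_zero (hne k.succ_ne_zero)
    exact (hs a ha).trans_le (Multiset.single_le_sum (fun b hb => (hs b hb).le) a ha)
  aeval_ne_zero z hz := by
    set L := lineRestrict P z fun i => (u i : ℂ) with hL
    have hsp : L.Splits := IsAlgClosed.splits L
    have hL0 : L.eval 0 ≠ 0 := by
      rw [hL, eval_lineRestrict]
      simpa using hP.aeval_ne_zero z hz
    have hLne : L ≠ 0 := by rintro h; simp [h] at hL0
    have hroot : ∀ r ∈ L.roots, r.im < 0 := fun r hr => by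
      have hr := (Polynomial.mem_roots hLne).mp hr
      rw [Polynomial.IsRoot, hL, eval_lineRestrict] at hr
      by_contra! h
      refine hP.aeval_ne_zero _ (fun i => ?_) hr
      simpa using add_pos_of_pos_of_nonneg (hz i) (mul_nonneg (hu i).le h)
    have h1 := hsp.eval_derivative_eq_eval_mul_sum hL0
    have h2 : L.derivative.eval 0 = aeval z (_root_.dirDeriv u P) := by
      have := derivative_lineRestrict (K := ℂ) P z u
      simp only [Complex.coe_algebraMap] at this
      rw [hL, this, eval_lineRestrict]; simp
    rw [← h2, h1]
    refine mul_ne_zero hL0 fun h => ?_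
    have hne : L.roots ≠ 0 := fun h => by
      have h1 := hsp.natDegree_eq_card_roots
      rw [h] at h1
      refine natDegree_lineRestrict_ne_zero hP.isHomogeneous _ _ ?_ h1
      rw [aeval_ofReal]
      exact_mod_cast (hP.eval_pos u hu).ne'
    have h3 : (L.roots.map fun r => -(1 / (0 - r)).im).sum = 0 := by
      rw [Multiset.sum_map_neg, neg_eq_zero]
      have h4 := congrArg Complex.imAddGroupHom h
      rw [map_zero, map_multiset_sum, Multiset.map_map] at h4
      exact h4
    obtain ⟨r, hr⟩ := Multiset.exists_mem_of_ne_zero hne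
    have hpos : ∀ r ∈ L.roots, 0 < -(1 / (0 - r)).im := fun r hr => by
      have h4 := hroot r hr
      have h5 : 0 < Complex.normSq r := Complex.normSq_pos.mpr fun h => by simp [h] at h4
      simp only [one_div, zero_sub, Complex.inv_im, Complex.neg_im, Complex.normSq_neg, neg_neg]
      rw [← neg_div]
      exact div_pos (by linarith) h5
    refine ((hpos r hr).trans_le ?_).ne' h3
    refine Multiset.single_le_sum (fun b hb => ?_) _
      (Multiset.mem_map_of_mem (fun r : ℂ => -(1 / (0 - r)).im) hr)
    obtain ⟨q, hq, rfl⟩ := Multiset.mem_map.mp hb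
    exact (hpos q hq).le

/-- The one-variable step of the capacity argument. -/
lemma le_eval_dirDeriv (hP : PosStable P (k + 1)) (hv : ∀ i, 0 < v i) (hu : ∀ i, 0 < u i)
    {c : ℝ} (h : ∀ t : ℝ, 0 < t → c * t ≤ eval (fun i => v i + u i * t) P) :
    c * ((k : ℝ) / (k + 1)) ^ k ≤ eval v (_root_.dirDeriv u P) := by
  obtain ⟨s, hs, hcard, hne, hline, hderiv⟩ := hP.exists_linear_factors hv hu
  have hvP := hP.eval_pos v hv
  have hS : 0 < s.sum := by
    obtain ⟨a, ha⟩ := Multiset.exists_mem_of_ne_zero (hne k.succ_ne_zero)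
    exact (hs a ha).trans_le (Multiset.single_le_sum (fun b hb => (hs b hb).le) a ha)
  have hub : ∀ t : ℝ, 0 < t → c * t ≤ eval v P * (1 + t * s.sum / (k + 1)) ^ (k + 1) := by
    intro t ht
    refine (h t ht).trans ?_
    rw [hline]
    refine mul_le_mul_of_nonneg_left ?_ hvP.le
    exact_mod_cast Multiset.prod_one_add_mul_le s (fun a ha => (hs a ha).le) k.succ_ne_zero hcard
      ht.le
  rw [hderiv]
  set p := eval v P
  set S := s.sum
  rcases Nat.eq_zero_or_pos k with rfl | hk
  · by_contra! hlt
    have hlt' : 0 < c - p * S := by simpa using hlt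
    have h1 := hub ((p + 1) / (c - p * S)) (by positivity)
    have h2 : (p + 1) / (c - p * S) * (c - p * S) = p + 1 := div_mul_cancel₀ _ hlt'.ne'
    simp only [Nat.cast_zero, zero_add, div_one, pow_one] at h1
    linarith
  · have hk' : (0 : ℝ) < k := by exact_mod_cast hk
    have h1 := hub ((k + 1) / (k * S)) (by positivity)
    have h2 : 1 + ((k : ℝ) + 1) / (k * S) * S / (k + 1) = (k + 1) / k := by
      field_simp
    rw [h2, pow_succ] at h1
    have h3 : ((k : ℝ) / (k + 1)) ^ k * (((k : ℝ) + 1) / k) ^ k = 1 := by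
      rw [← mul_pow, div_mul_div_cancel₀ (by positivity), div_self hk'.ne', one_pow]
    have h4 := mul_le_mul_of_nonneg_left h1
      (show 0 ≤ ((k : ℝ) / (k + 1)) ^ k * (k * S / (k + 1)) by positivity)
    calc c * ((k : ℝ) / (k + 1)) ^ k
        = ((k : ℝ) / (k + 1)) ^ k * (k * S / (k + 1)) * (c * ((k + 1) / (k * S))) := by
          field_simp
      _ ≤ _ := h4
      _ = p * S * (((k : ℝ) / (k + 1)) ^ k * (((k : ℝ) + 1) / k) ^ k) := by
          field_simp
      _ = p * S := by rw [h3, mul_one]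

/-- Gurvits's inequality: a capacity bound `c` for `P` with respect to positive vectors `a j`
bounds the mixed derivative of `P` along them from below by `c * k! / k ^ k`. -/
lemma le_eval_iterDirDeriv [Fintype ι] {k : ℕ} {P : MvPolynomial ι ℝ} (hP : PosStable P k)
    (a : Fin k → ι → ℝ) (ha : ∀ j i, 0 < a j i) {c : ℝ} (hc : 0 ≤ c)
    (h : ∀ x : Fin k → ℝ, (∀ j, 0 < x j) →
      c * ∏ j, x j ≤ eval (fun i => ∑ j, a j i * x j) P) :
    c * (k.factorial / (k : ℝ) ^ k) ≤ eval 0 (iterDirDeriv a P) := by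
  induction k generalizing P c with
  | zero =>
    have := h 0 finZeroElim
    simpa [iterDirDeriv] using! this
  | succ k ih =>
    have hg : c * ((k + 1).factorial / ((k + 1 : ℕ) : ℝ) ^ (k + 1)) =
        c * ((k : ℝ) / (k + 1)) ^ k * (k.factorial / (k : ℝ) ^ k) := by
      have : (k : ℝ) ^ k ≠ 0 := by
        rcases Nat.eq_zero_or_pos k with rfl | hk <;> positivity
      rw [Nat.factorial_succ, div_pow]
      push_cast
      field_simp
      ring
    rw [hg]
    refine ih (hP.dirDeriv (ha 0)) (fun j => a j.succ) (fun j => ha j.succ) (by positivity)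
      fun x hx => ?_
    rcases Nat.eq_zero_or_pos k with rfl | hk
    · have h0 := aeval_mul_of_isHomogeneous (hP.dirDeriv (ha 0)).isHomogeneous (0 : ℝ) (a 0)
      simp only [zero_mul, pow_zero, one_mul, aeval_eq_eval] at h0
      simp only [Finset.univ_eq_empty, Finset.prod_empty, Finset.sum_empty, mul_one, h0]
      refine hP.le_eval_dirDeriv (ha 0) (ha 0) fun t ht => ?_
      have h1 := h (fun _ => 1 + t) fun _ => by positivity
      simp only [Fin.prod_univ_succ, Fin.sum_univ_succ, Finset.univ_eq_empty, Finset.prod_empty,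
        Finset.sum_empty, add_zero, mul_add, mul_one] at h1
      linarith
    · rw [mul_right_comm]
      refine hP.le_eval_dirDeriv (fun i => ?_) (ha 0) fun t ht => ?_
      · have : Nonempty (Fin k) := ⟨⟨0, hk⟩⟩
        exact Finset.sum_pos (fun j _ => mul_pos (ha _ _) (hx j)) Finset.univ_nonempty
      · have h1 := h (Fin.cons t x) fun j => by
          refine Fin.cases ?_ (fun j => ?_) j
          · simpa using ht
          · simpa using hx j
        simp only [Fin.prod_univ_succ, Fin.sum_univ_succ, Fin.cons_zero, Fin.cons_succ] at h1
        simp_rw [add_comm (∑ j, _)]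
        linarith

end PosStable

lemma dirDeriv_prod_X [DecidableEq ι] (u : ι → ℝ) (S : Finset ι) :
    dirDeriv u (∏ i ∈ S, X i) = ∑ i ∈ S, u i • ∏ j ∈ S.erase i, X j := by
  induction S using Finset.induction_on with
  | empty => simp
  | insert i S hi ih =>
    rw [Finset.prod_insert hi, Derivation.leibniz, ih, Finset.sum_insert hi,
      Finset.erase_insert hi, add_comm, dirDeriv, mkDerivation_X, Finset.smul_sum]
    congr 1
    · rw [smul_eq_mul, smul_eq_C_mul, mul_comm]
    · refine Finset.sum_congr rfl fun j hj => ?_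
      have hij : i ≠ j := fun h => hi (h ▸ hj)
      rw [Finset.erase_insert_of_ne hij, Finset.prod_insert (by simp [hi]), smul_eq_mul,
        mul_smul_comm]

lemma eval_iterDirDeriv_prod_X [Fintype ι] [DecidableEq ι] {k : ℕ} (a : Fin k → ι → ℝ)
    {S : Finset ι} (hS : S.card = k) :
    eval 0 (iterDirDeriv a (∏ i ∈ S, X i)) =
      ∑ f : Fin k → ι, if Finset.univ.image f = S then ∏ j, a j (f j) else 0 := by
  induction k generalizing S with
  | zero => simp [Finset.card_eq_zero.mp hS, iterDirDeriv]
  | succ k ih =>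
    have himage : ∀ (i : ι) (g : Fin k → ι),
        Finset.univ.image (Fin.cons i g : Fin (k + 1) → ι) = S ↔
          i ∈ S ∧ Finset.univ.image g = S.erase i := by
      intro i g
      have h1 : Finset.univ.image (Fin.cons i g : Fin (k + 1) → ι) =
          insert i (Finset.univ.image g) := by
        ext j; simp [Fin.exists_fin_succ, eq_comm]
      rw [h1]
      constructor
      · rintro rfl
        refine ⟨Finset.mem_insert_self _ _, (Finset.erase_insert fun hi => ?_).symm⟩
        rw [Finset.insert_eq_of_mem hi] at hS
        have := Finset.card_image_le (s := Finset.univ) (f := g)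
        rw [hS] at this
        simp at this
      · rintro ⟨hi, h⟩
        rw [h, Finset.insert_erase hi]
    have hcons : ∀ (i : ι) (g : Fin k → ι),
        (Fin.consEquiv fun _ : Fin (k + 1) => ι) (i, g) = Fin.cons i g := fun _ _ => rfl
    rw [← (Fin.consEquiv fun _ : Fin (k + 1) => ι).sum_comp, Fintype.sum_prod_type]
    simp only [hcons, himage, Fin.prod_univ_succ, Fin.cons_zero, Fin.cons_succ]
    rw [iterDirDeriv, LinearMap.comp_apply]
    change eval 0 (iterDirDeriv _ (dirDeriv (a 0) _)) = _
    rw [dirDeriv_prod_X, map_sum, map_sum, ← Finset.sum_subset (Finset.subset_univ S)]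
    · refine Finset.sum_congr rfl fun i hi => ?_
      rw [map_smul, smul_eval, ih _ (by rw [Finset.card_erase_of_mem hi, hS]; rfl),
        Finset.mul_sum]
      exact Finset.sum_congr rfl fun g _ => by simp [hi]
    · intro i _ hi
      simp [hi]

end PositiveStable

lemma Matrix.permanent_eq_eval_iterDirDeriv {n : ℕ} (A : Matrix (Fin n) (Fin n) ℝ) :
    A.permanent =
      MvPolynomial.eval 0 (iterDirDeriv (fun j i => A i j) (∏ i, MvPolynomial.X i)) := by
  rw [eval_iterDirDeriv_prod_X _ (by simp), Matrix.permanent, ← Finset.sum_filter]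
  refine Finset.sum_bij (fun σ _ => σ) (fun σ _ => ?_) (fun σ _ τ _ h => DFunLike.coe_injective h)
    (fun f hf => ?_) fun σ _ => rfl
  · simpa [Finset.eq_univ_iff_forall] using! σ.surjective
  · have hsurj : Function.Surjective f := by
      simpa [Finset.eq_univ_iff_forall] using! hf
    exact ⟨Equiv.ofBijective f hsurj.bijective_of_finite, Finset.mem_univ _, rfl⟩

lemma prod_le_prod_sum_mul_of_sum_eq_one {m n : Type*} [Fintype m] [Fintype n] {A : Matrix m n ℝ}
    (hnonneg : ∀ i j, 0 ≤ A i j) (hrow : ∀ i, ∑ j, A i j = 1) (hcol : ∀ j, ∑ i, A i j = 1)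
    {x : n → ℝ} (hx : ∀ j, 0 < x j) : ∏ j, x j ≤ ∏ i, ∑ j, A i j * x j := by
  calc ∏ j, x j = ∏ j, ∏ i, x j ^ A i j := by
        refine Finset.prod_congr rfl fun j _ => ?_
        rw [← Real.rpow_sum_of_pos (hx j), hcol, Real.rpow_one]
    _ = ∏ i, ∏ j, x j ^ A i j := Finset.prod_comm
    _ ≤ _ := Finset.prod_le_prod
        (fun i _ => Finset.prod_nonneg fun j _ => Real.rpow_nonneg (hx j).le _)
        fun i _ => Real.geom_mean_le_arith_mean_weighted _ _ _ (fun j _ => hnonneg i j) (hrow i)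
          fun j _ => (hx j).le

lemma factorial_div_pow_le_permanent_of_pos {n : ℕ} {A : Matrix (Fin n) (Fin n) ℝ}
    (hpos : ∀ i j, 0 < A i j) (hrow : ∀ i, ∑ j, A i j = 1) (hcol : ∀ j, ∑ i, A i j = 1) :
    (n.factorial : ℝ) / (n : ℝ) ^ n ≤ A.permanent := by
  have hP := posStable_prod_X (ι := Fin n)
  rw [Fintype.card_fin] at hP
  rw [Matrix.permanent_eq_eval_iterDirDeriv]
  simpa using hP.le_eval_iterDirDeriv (fun j i => A i j) (fun j i => hpos i j) zero_le_one
    fun x hx => by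
      simpa using prod_le_prod_sum_mul_of_sum_eq_one (fun i j => (hpos i j).le) hrow hcol hx

/-- van der Waerden's conjecture, proved by Egorychev and Falikman:
the permanent of any doubly stochastic `d × d` matrix, `d = n + 1 ≥ 1`, is at least `d!/d^d`. -/
theorem permanent_doublyStochastic_ge (n : ℕ) (A : Matrix (Fin (n + 1)) (Fin (n + 1)) ℝ)
    (hnonneg : ∀ i j, 0 ≤ A i j)
    (hrow : ∀ i, ∑ j, A i j = 1) (hcol : ∀ j, ∑ i, A i j = 1) :
    A.permanent ≥ (Nat.factorial (n + 1) : ℝ) / (n + 1 : ℝ) ^ (n + 1) := by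
  let B : ℝ → Matrix (Fin (n + 1)) (Fin (n + 1)) ℝ :=
    fun ε => Matrix.of fun i j => (1 - ε) * A i j + ε / (n + 1)
  have hn : (n : ℝ) + 1 ≠ 0 := by positivity
  have hcont : Continuous fun ε => (B ε).permanent := by
    simp only [Matrix.permanent, B, Matrix.of_apply]
    fun_prop
  have hB0 : B 0 = A := by ext i j; simp [B]
  have hlim : Filter.Tendsto (fun ε => (B ε).permanent) (nhdsWithin 0 (Set.Ioi 0))
      (nhds A.permanent) := by
    have := hcont.tendsto 0
    rw [hB0] at this
    exact this.mono_left nhdsWithin_le_nhds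
  refine ge_of_tendsto hlim ?_
  filter_upwards [Ioo_mem_nhdsGT (zero_lt_one' ℝ)] with ε hε
  have h1 : 0 < 1 - ε := sub_pos.mpr hε.2
  have h2 := factorial_div_pow_le_permanent_of_pos (A := B ε)
    (fun i j => add_pos_of_nonneg_of_pos (mul_nonneg h1.le (hnonneg i j))
      (div_pos hε.1 (by positivity)))
    (fun i => by
      simp only [B, Matrix.of_apply, Finset.sum_add_distrib, ← Finset.mul_sum, hrow]
      simp
      field_simp
      ring)
    (fun j => by
      simp only [B, Matrix.of_apply, Finset.sum_add_distrib, ← Finset.mul_sum, hcol]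
      simp
      field_simp
      ring)
  exact_mod_cast h2
end

section
/- Let P_1, …, P_d be convex bodies in ℝ^d. Then there exists a real polynomial Q in d variables, homogeneous of degree d, such that for all nonnegative real numbers t_1, …, t_d, the Lebesgue volume of the Minkowski sum t_1 P_1 + ⋯ + t_d P_d equals Q(t_1, …, t_d). -/
open Pointwise MeasureTheory

open Filter Topology InnerProductSpace

section Gibbs

variable {E ι : Type*} [NormedAddCommGroup E] [InnerProductSpace ℝ E] [Fintype ι]

/-- The log-sum-exp function `x ↦ log ∑ₖ exp ⟪v k, x⟫`. -/
noncomputable def logSumExp (v : ι → E) (x : E) : ℝ :=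
  Real.log (∑ k, Real.exp (inner ℝ (v k) x))

/-- The Gibbs (softmax) weights of the points `v k` at `x`. -/
noncomputable def gibbsWeight (v : ι → E) (x : E) (k : ι) : ℝ :=
  Real.exp (inner ℝ (v k) x - logSumExp v x)

/-- The mean of the points `v k` under the Gibbs weights at `x`. -/
noncomputable def gibbsMean (v : ι → E) (x : E) : E :=
  ∑ k, gibbsWeight v x k • v k

/-- The covariance operator of the points `v k` under the Gibbs weights at `x`. -/
noncomputable def gibbsCov (v : ι → E) (x : E) : E →L[ℝ] E :=
  ∑ k, gibbsWeight v x k • rankOne ℝ (v k - gibbsMean v x) (v k - gibbsMean v x)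

theorem gibbsWeight_pos (v : ι → E) (x : E) (k : ι) : 0 < gibbsWeight v x k :=
  Real.exp_pos _

theorem gibbsCov_isPositive (v : ι → E) (x : E) : (gibbsCov v x).IsPositive :=
  ContinuousLinearMap.isPositive_sum _ fun k _ =>
    (isPositive_rankOne_self (𝕜 := ℝ) (v k - gibbsMean v x)).smul_of_nonneg
      (gibbsWeight_pos v x k).le

theorem inner_gibbsCov_self (v : ι → E) (x u : E) :
    inner ℝ (gibbsCov v x u) u
      = ∑ k, gibbsWeight v x k * inner ℝ (v k - gibbsMean v x) u ^ 2 := by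
  simp only [gibbsCov, _root_.sum_apply, _root_.smul_apply,
    rankOne_apply, sum_inner, real_inner_smul_left, sq]

theorem inner_eq_of_inner_gibbsCov_self_eq_zero {v : ι → E} {x u : E}
    (h : inner ℝ (gibbsCov v x u) u = 0) (k : ι) :
    inner ℝ (v k) u = inner ℝ (gibbsMean v x) u := by
  rw [inner_gibbsCov_self, Finset.sum_eq_zero_iff_of_nonneg
    fun k _ => mul_nonneg (gibbsWeight_pos v x k).le (sq_nonneg _)] at h
  have hk := (mul_eq_zero.1 (h k (Finset.mem_univ k))).resolve_left (gibbsWeight_pos v x k).ne'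
  rwa [sq_eq_zero_iff, inner_sub_left, sub_eq_zero] at hk

variable [Nonempty ι]

theorem sum_exp_inner_pos (v : ι → E) (x : E) : 0 < ∑ k, Real.exp (inner ℝ (v k) x) :=
  Finset.sum_pos (fun _ _ => Real.exp_pos _) Finset.univ_nonempty

theorem gibbsWeight_eq_div (v : ι → E) (x : E) (k : ι) :
    gibbsWeight v x k = Real.exp (inner ℝ (v k) x) / ∑ l, Real.exp (inner ℝ (v l) x) := by
  rw [gibbsWeight, logSumExp, Real.exp_sub, Real.exp_log (sum_exp_inner_pos v x)]

theorem sum_gibbsWeight (v : ι → E) (x : E) : ∑ k, gibbsWeight v x k = 1 := by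
  simp_rw [gibbsWeight_eq_div, ← Finset.sum_div]
  exact div_self (sum_exp_inner_pos v x).ne'

theorem gibbsMean_mem_convexHull (v : ι → E) (x : E) :
    gibbsMean v x ∈ convexHull ℝ (Set.range v) :=
  (convex_convexHull ℝ _).sum_mem (fun k _ => (gibbsWeight_pos v x k).le) (sum_gibbsWeight v x)
    fun k _ => subset_convexHull ℝ _ ⟨k, rfl⟩

theorem sum_gibbsWeight_smul_sub (v : ι → E) (x : E) :
    ∑ k, gibbsWeight v x k • (v k - gibbsMean v x) = 0 := by
  simp_rw [smul_sub, Finset.sum_sub_distrib, ← Finset.sum_smul, sum_gibbsWeight, one_smul]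
  exact sub_self _

/-- Every linear functional is bounded on the convex hull of the points by log-sum-exp. -/
theorem inner_le_logSumExp (v : ι → E) (x : E) {y : E} (hy : y ∈ convexHull ℝ (Set.range v)) :
    inner ℝ y x ≤ logSumExp v x := by
  have hconv : Convex ℝ {y : E | inner ℝ y x ≤ logSumExp v x} :=
    convex_halfSpace_le
      ⟨fun a b => inner_add_left a b x, fun c a => real_inner_smul_left a x c⟩ _
  refine convexHull_min ?_ hconv hy
  rintro _ ⟨k, rfl⟩
  rw [Set.mem_ofPred_eq, logSumExp, Real.le_log_iff_exp_le (sum_exp_inner_pos v x)]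
  exact Finset.single_le_sum (f := fun k => Real.exp (inner ℝ (v k) x))
    (fun _ _ => (Real.exp_pos _).le) (Finset.mem_univ k)

theorem hasFDerivAt_logSumExp (v : ι → E) (x : E) :
    HasFDerivAt (logSumExp v) (innerSL ℝ (gibbsMean v x)) x := by
  have h : ∀ k ∈ Finset.univ, HasFDerivAt (fun x => Real.exp (inner ℝ (v k) x))
      (Real.exp (inner ℝ (v k) x) • innerSL ℝ (v k)) x :=
    fun k _ => ((innerSL ℝ (v k)).hasFDerivAt (x := x)).exp
  refine ((HasFDerivAt.fun_sum h).log (sum_exp_inner_pos v x).ne').congr_fderiv ?_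
  simp only [gibbsMean, map_sum, map_smul, Finset.smul_sum, smul_smul, gibbsWeight_eq_div]
  exact Finset.sum_congr rfl fun k _ => by rw [div_eq_inv_mul]

theorem hasFDerivAt_gibbsWeight (v : ι → E) (x : E) (k : ι) :
    HasFDerivAt (fun x => gibbsWeight v x k)
      (gibbsWeight v x k • innerSL ℝ (v k - gibbsMean v x)) x := by
  rw [map_sub]
  exact (((innerSL ℝ (v k)).hasFDerivAt (x := x)).sub (hasFDerivAt_logSumExp v x)).exp

theorem hasFDerivAt_gibbsMean (v : ι → E) (x : E) :
    HasFDerivAt (gibbsMean v) (gibbsCov v x) x := by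
  refine (HasFDerivAt.fun_sum fun k (_ : k ∈ Finset.univ) =>
    (hasFDerivAt_gibbsWeight v x k).smul_const (v k)).congr_fderiv ?_
  ext u
  have h : ∑ k, (gibbsWeight v x k * inner ℝ (v k - gibbsMean v x) u) • gibbsMean v x = 0 := by
    rw [← Finset.sum_smul]
    simp_rw [← real_inner_smul_left]
    rw [← sum_inner, sum_gibbsWeight_smul_sub, inner_zero_left, zero_smul]
  simp only [gibbsCov, _root_.sum_apply, _root_.smul_apply,
    rankOne_apply, ContinuousLinearMap.smulRight_apply, smul_smul, smul_sub,
    Finset.sum_sub_distrib, innerSL_apply_apply, smul_eq_mul]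
  rw [h, sub_zero]

theorem continuous_gibbsMean (v : ι → E) : Continuous (gibbsMean v) :=
  continuous_iff_continuousAt.2 fun x => (hasFDerivAt_gibbsMean v x).continuousAt

theorem continuous_gibbsCov (v : ι → E) : Continuous (gibbsCov v) := by
  have hw : ∀ k, Continuous fun x => gibbsWeight v x k := fun k =>
    continuous_iff_continuousAt.2 fun x => (hasFDerivAt_gibbsWeight v x k).continuousAt
  have hm := continuous_gibbsMean v
  refine continuous_finsetSum _ fun k _ => (hw k).smul ?_
  have hd : Continuous fun x => v k - gibbsMean v x := continuous_const.sub hm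
  exact ((rankOne ℝ (E := E) (F := E)).continuous.comp hd).clm_apply hd

end Gibbs

section GibbsSum

variable {E ι κ : Type*} [NormedAddCommGroup E] [InnerProductSpace ℝ E] [Fintype ι] [Fintype κ]

theorem isCompact_sum_smul {P : κ → Set E} (hP : ∀ i, IsCompact (P i)) (t : κ → ℝ) :
    IsCompact (∑ i, t i • P i) :=
  Finset.sum_induction _ IsCompact (fun _ _ => IsCompact.add) isCompact_singleton
    fun i _ => (hP i).smul (t i)

theorem convex_sum_smul {P : κ → Set E} (hP : ∀ i, Convex ℝ (P i)) (t : κ → ℝ) :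
    Convex ℝ (∑ i, t i • P i) :=
  Finset.sum_induction _ (Convex ℝ) (fun _ _ => Convex.add) (convex_singleton 0)
    fun i _ => (hP i).smul (t i)

theorem mem_sum_smul_iff {P : κ → Set E} {t : κ → ℝ} {y : E} :
    y ∈ ∑ i, t i • P i ↔ ∃ p : κ → E, (∀ i, p i ∈ P i) ∧ ∑ i, t i • p i = y := by
  rw [Set.mem_fintype_sum]
  constructor
  · rintro ⟨g, hg, rfl⟩
    choose p hp hpg using fun i => Set.mem_smul_set.1 (hg i)
    exact ⟨p, hp, Finset.sum_congr rfl fun i _ => hpg i⟩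
  · rintro ⟨p, hp, rfl⟩
    exact ⟨fun i => t i • p i, fun i => Set.smul_mem_smul_set (hp i), rfl⟩

variable [Nonempty ι] (v : κ → ι → E) {t : κ → ℝ}

theorem hasFDerivAt_sum_smul_gibbsMean (t : κ → ℝ) (x : E) :
    HasFDerivAt (fun x => ∑ i, t i • gibbsMean (v i) x) (∑ i, t i • gibbsCov (v i) x) x :=
  HasFDerivAt.fun_sum fun i _ => (hasFDerivAt_gibbsMean (v i) x).const_smul (t i)

theorem injective_sum_smul_gibbsMean (ht : ∀ i, 0 < t i)
    (hv : ∀ u : E, (∀ i k l, inner ℝ (v i k) u = inner ℝ (v i l) u) → u = 0) :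
    Function.Injective fun x => ∑ i, t i • gibbsMean (v i) x := by
  intro x y hxy
  by_contra hne
  set u := x - y with hu
  have hpos : ∀ z, 0 < inner ℝ ((∑ i, t i • gibbsCov (v i) z) u) u := by
    intro z
    have hnn : ∀ i ∈ Finset.univ, 0 ≤ t i * inner ℝ (gibbsCov (v i) z u) u := fun i _ =>
      mul_nonneg (ht i).le ((gibbsCov_isPositive (v i) z).inner_nonneg_left u)
    simp only [_root_.sum_apply, _root_.smul_apply, sum_inner, real_inner_smul_left]
    refine (Finset.sum_nonneg hnn).lt_of_ne fun h0 => hne (sub_eq_zero.1 (hv u fun i k l => ?_))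
    have h := (mul_eq_zero.1 ((Finset.sum_eq_zero_iff_of_nonneg hnn).1 h0.symm i
      (Finset.mem_univ i))).resolve_left (ht i).ne'
    rw [inner_eq_of_inner_gibbsCov_self_eq_zero h k, inner_eq_of_inner_gibbsCov_self_eq_zero h l]
  have hder : ∀ s : ℝ, HasDerivAt
      (fun s : ℝ => inner ℝ (∑ i, t i • gibbsMean (v i) (y + s • u)) u)
      (inner ℝ ((∑ i, t i • gibbsCov (v i) (y + s • u)) u) u) s := by
    intro s
    have hline : HasDerivAt (fun s : ℝ => y + s • u) u s := by
      simpa using ((hasDerivAt_id s).smul_const u).const_add y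
    have h := ((hasFDerivAt_sum_smul_gibbsMean v t (y + s • u)).comp_hasDerivAt s hline).inner ℝ
      (hasDerivAt_const s u)
    simpa using h
  have hmono := strictMono_of_deriv_pos fun s => (hder s).deriv ▸ hpos (y + s • u)
  have h01 := hmono (zero_lt_one' ℝ)
  simp only [zero_smul, add_zero, one_smul, hu, add_sub_cancel] at h01
  exact h01.ne (congrArg (fun z => inner ℝ z (x - y)) hxy).symm

theorem sum_smul_gibbsMean_mem (t : κ → ℝ) (x : E) :
    ∑ i, t i • gibbsMean (v i) x ∈ ∑ i, t i • convexHull ℝ (Set.range (v i)) :=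
  mem_sum_smul_iff.2 ⟨_, fun i => gibbsMean_mem_convexHull (v i) x, rfl⟩

theorem inner_le_sum_mul_logSumExp (ht : ∀ i, 0 < t i) {y : E}
    (hy : y ∈ ∑ i, t i • convexHull ℝ (Set.range (v i))) (x : E) :
    inner ℝ y x ≤ ∑ i, t i * logSumExp (v i) x := by
  obtain ⟨p, hp, rfl⟩ := mem_sum_smul_iff.1 hy
  simp only [sum_inner, real_inner_smul_left]
  exact Finset.sum_le_sum fun i _ =>
    mul_le_mul_of_nonneg_left (inner_le_logSumExp (v i) x (hp i)) (ht i).le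

theorem interior_subset_range_sum_smul_gibbsMean [FiniteDimensional ℝ E] (ht : ∀ i, 0 < t i) :
    interior (∑ i, t i • convexHull ℝ (Set.range (v i)))
      ⊆ Set.range fun x => ∑ i, t i • gibbsMean (v i) x := by
  intro y hy
  obtain ⟨r, hr, hball⟩ := Metric.nhds_basis_closedBall.mem_iff.1 (mem_interior_iff_mem_nhds.1 hy)
  set f : E → ℝ := fun x => ∑ i, t i * logSumExp (v i) x - inner ℝ y x with hf
  have hfd : ∀ x, HasFDerivAt f (innerSL ℝ (∑ i, t i • gibbsMean (v i) x - y)) x := by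
    intro x
    rw [map_sub, map_sum]
    simp_rw [map_smul]
    exact (HasFDerivAt.fun_sum fun i _ => (hasFDerivAt_logSumExp (v i) x).const_mul (t i)).sub
      (innerSL ℝ y).hasFDerivAt
  have hcoer : ∀ x, r * ‖x‖ ≤ f x := by
    intro x
    rcases eq_or_ne x 0 with rfl | hx
    · have := inner_le_sum_mul_logSumExp v ht (interior_subset hy) 0
      simp only [hf, norm_zero, mul_zero]
      linarith
    have hx' : ‖x‖ ≠ 0 := norm_ne_zero_iff.2 hx
    have hmem : y + (r / ‖x‖) • x ∈ Metric.closedBall y r := by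
      simp [norm_smul, abs_of_pos hr, hx']
    have h := inner_le_sum_mul_logSumExp v ht (hball hmem) x
    rw [inner_add_left, real_inner_smul_left, real_inner_self_eq_norm_sq, sq, ← mul_assoc,
      div_mul_cancel₀ _ hx'] at h
    simp only [hf]
    linarith
  have hcont : Continuous f := continuous_iff_continuousAt.2 fun x => (hfd x).continuousAt
  have htend : Tendsto f (cocompact E) atTop :=
    tendsto_atTop_mono hcoer ((tendsto_norm_cocompact_atTop (E := E)).const_mul_atTop hr)
  obtain ⟨x, hx⟩ := hcont.exists_forall_le' 0 (htend.eventually_ge_atTop (f 0))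
  have h0 := IsLocalMin.hasFDerivAt_eq_zero (Eventually.of_forall hx) (hfd x)
  refine ⟨x, sub_eq_zero.1 ?_⟩
  rw [← inner_self_eq_zero (𝕜 := ℝ), ← innerSL_apply_apply ℝ, h0]
  rfl

end GibbsSum

section Volume

variable {ι κ : Type*} [Fintype ι] [Fintype κ]

/-- The functions on the open positive orthant of `ℝ^κ` that are given by homogeneous polynomials
of degree `d`. -/
def homogeneousFunctions (κ : Type*) (d : ℕ) : Submodule ℝ ({t : κ → ℝ // ∀ i, 0 < t i} → ℝ) :=
  Submodule.span ℝ (Set.range fun φ : Fin d → κ => fun t => ∏ j, t.1 (φ j))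

theorem isClosed_homogeneousFunctions (κ : Type*) [Finite κ] (d : ℕ) :
    IsClosed (homogeneousFunctions κ d : Set ({t : κ → ℝ // ∀ i, 0 < t i} → ℝ)) := by
  have : FiniteDimensional ℝ (homogeneousFunctions κ d) :=
    FiniteDimensional.span_of_finite ℝ (Set.finite_range _)
  exact Submodule.closed_of_finiteDimensional _

/-- The entries of the Hessian matrix of `logSumExp`. -/
noncomputable def gibbsMatrix {d : ℕ} (v : ι → EuclideanSpace ℝ (Fin d))
    (x : EuclideanSpace ℝ (Fin d)) : Matrix (Fin d) (Fin d) ℝ :=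
  LinearMap.toMatrix (EuclideanSpace.basisFun (Fin d) ℝ).toBasis
    (EuclideanSpace.basisFun (Fin d) ℝ).toBasis (gibbsCov v x : _ →ₗ[ℝ] _)

theorem continuous_gibbsMatrix [Nonempty ι] {d : ℕ} (v : ι → EuclideanSpace ℝ (Fin d)) :
    Continuous (gibbsMatrix v) := by
  refine continuous_matrix fun j k => ?_
  simp only [gibbsMatrix, LinearMap.toMatrix_apply, OrthonormalBasis.coe_toBasis,
    OrthonormalBasis.coe_toBasis_repr_apply, EuclideanSpace.basisFun_repr,
    EuclideanSpace.basisFun_apply, ContinuousLinearMap.coe_coe]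
  have h := (continuous_gibbsCov v).clm_apply
    (continuous_const (y := EuclideanSpace.single k (1 : ℝ)))
  fun_prop

theorem det_sum_smul_gibbsCov {d : ℕ} (v : κ → ι → EuclideanSpace ℝ (Fin d))
    (t : κ → ℝ) (x : EuclideanSpace ℝ (Fin d)) :
    (∑ i, t i • gibbsCov (v i) x).det
      = ∑ φ : Fin d → κ, (Matrix.of fun j => gibbsMatrix (v (φ j)) x j).det * ∏ j, t (φ j) := by
  have hdet : (∑ i, t i • gibbsCov (v i) x).det = (∑ i, t i • gibbsMatrix (v i) x).det := by
    rw [ContinuousLinearMap.det,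
      ← LinearMap.det_toMatrix (EuclideanSpace.basisFun (Fin d) ℝ).toBasis]
    simp [gibbsMatrix]
  have hrow : (∑ i, t i • gibbsMatrix (v i) x).det
      = Matrix.detRowAlternating.toMultilinearMap
          fun j => ∑ i, t i • gibbsMatrix (v i) x j :=
    congrArg Matrix.detRowAlternating
      (funext fun j => funext fun k => by simp [Matrix.sum_apply])
  rw [hdet, hrow, MultilinearMap.map_sum]
  refine Finset.sum_congr rfl fun φ _ => ?_
  rw [MultilinearMap.map_smul_univ, smul_eq_mul, mul_comm]
  rfl

theorem det_sum_smul_gibbsCov_nonneg {d : ℕ} (v : κ → ι → EuclideanSpace ℝ (Fin d))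
    {t : κ → ℝ} (ht : ∀ i, 0 < t i) (x : EuclideanSpace ℝ (Fin d)) :
    0 ≤ (∑ i, t i • gibbsCov (v i) x).det := by
  have hpos : (∑ i, t i • gibbsCov (v i) x).IsPositive :=
    ContinuousLinearMap.isPositive_sum _ fun i _ =>
      (gibbsCov_isPositive (v i) x).smul_of_nonneg (ht i).le
  rw [ContinuousLinearMap.det,
    ← LinearMap.det_toMatrix (EuclideanSpace.basisFun (Fin d) ℝ).toBasis]
  exact (LinearMap.posSemidef_toMatrix_iff _ |>.2
    ((ContinuousLinearMap.isPositive_toLinearMap_iff _).2 hpos)).det_nonneg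

omit [Fintype κ] in
theorem continuous_det_of_rows {X n : Type*} [TopologicalSpace X] [Fintype n] [DecidableEq n]
    {M : κ → X → Matrix n n ℝ} (hM : ∀ i, Continuous (M i)) (φ : n → κ) :
    Continuous fun x => (Matrix.of fun j => M (φ j) x j).det := by
  refine Continuous.matrix_det (continuous_matrix fun j k => ?_)
  simp only [Matrix.of_apply]
  exact (hM (φ j)).matrix_elem j k

theorem volume_image_closedBall_mem_homogeneousFunctions [Nonempty ι] {d : ℕ}
    (v : κ → ι → EuclideanSpace ℝ (Fin d))
    (hv : ∀ u, (∀ i k l, inner ℝ (v i k) u = inner ℝ (v i l) u) → u = 0) (r : ℝ) :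
    (fun t : {t : κ → ℝ // ∀ i, 0 < t i} =>
      (volume ((fun x => ∑ i, t.1 i • gibbsMean (v i) x) '' Metric.closedBall 0 r)).toReal)
        ∈ homogeneousFunctions κ d := by
  set B : Set (EuclideanSpace ℝ (Fin d)) := Metric.closedBall 0 r
  set c : (Fin d → κ) → EuclideanSpace ℝ (Fin d) → ℝ :=
    fun φ x => (Matrix.of fun j => gibbsMatrix (v (φ j)) x j).det
  have hcont : ∀ φ, Continuous (c φ) := fun φ =>
    continuous_det_of_rows (fun i => continuous_gibbsMatrix (v i)) φ
  have hint : ∀ φ, IntegrableOn (c φ) B := fun φ =>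
    (hcont φ).continuousOn.integrableOn_compact (isCompact_closedBall 0 r)
  rw [homogeneousFunctions, Submodule.mem_span_range_iff_exists_fun]
  refine ⟨fun φ => ∫ x in B, c φ x, ?_⟩
  ext ⟨t, ht⟩
  have hsum : IntegrableOn (fun x => ∑ φ, c φ x * ∏ j, t (φ j)) B :=
    integrable_finsetSum _ fun φ _ => (hint φ).mul_const _
  have hdet : ∀ x, |(∑ i, t i • gibbsCov (v i) x).det| = ∑ φ, c φ x * ∏ j, t (φ j) := fun x => by
    rw [abs_of_nonneg (det_sum_smul_gibbsCov_nonneg v ht x), det_sum_smul_gibbsCov v t x]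
  have hvol : ∫⁻ x in B, ENNReal.ofReal (∑ φ, c φ x * ∏ j, t (φ j))
      = volume ((fun x => ∑ i, t i • gibbsMean (v i) x) '' B) := by
    rw [← lintegral_abs_det_fderiv_eq_addHaar_image volume measurableSet_closedBall
      (fun x _ => (hasFDerivAt_sum_smul_gibbsMean v t x).hasFDerivWithinAt)
      (injective_sum_smul_gibbsMean v ht hv).injOn]
    exact lintegral_congr fun x => by rw [hdet]
  have hnonneg : ∀ x, 0 ≤ ∑ φ, c φ x * ∏ j, t (φ j) := fun x => hdet x ▸ abs_nonneg _
  have htoReal := integral_eq_lintegral_of_nonneg_ae (Eventually.of_forall hnonneg)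
    hsum.aestronglyMeasurable
  rw [hvol, integral_finsetSum _ fun φ _ => (hint φ).mul_const _] at htoReal
  simp_rw [integral_mul_const] at htoReal
  rw [← htoReal, Finset.sum_apply]
  exact Finset.sum_congr rfl fun φ _ => by rw [Pi.smul_apply, smul_eq_mul]

theorem volume_eq_zero_of_inner_eq {d : ℕ} {K : Set (EuclideanSpace ℝ (Fin d))}
    (hK : Convex ℝ K) {u : EuclideanSpace ℝ (Fin d)} (hu : u ≠ 0) {c : ℝ}
    (h : ∀ y ∈ K, inner ℝ y u = c) : volume K = 0 := by
  have hint : interior K = ∅ := by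
    refine Set.eq_empty_of_forall_notMem fun y hy => ?_
    have hline : Tendsto (fun s : ℝ => y + s • u) (𝓝[≠] 0) (𝓝 y) := by
      have : Continuous fun s : ℝ => y + s • u := by fun_prop
      simpa using (this.tendsto 0).mono_left nhdsWithin_le_nhds
    obtain ⟨s, hs, hs0⟩ :=
      ((hline.eventually (mem_interior_iff_mem_nhds.1 hy)).and self_mem_nhdsWithin).exists
    have h1 := h _ hs
    rw [inner_add_left, h y (interior_subset hy), real_inner_smul_left, add_eq_left] at h1
    exact (mul_ne_zero hs0 (inner_self_ne_zero.2 hu)) h1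
  refine measure_mono_null (subset_closure.trans ?_) (hK.addHaar_frontier volume)
  rw [frontier, hint, Set.sdiff_empty]

theorem volume_polytopes_mem_homogeneousFunctions [Nonempty ι] {d : ℕ}
    (v : κ → ι → EuclideanSpace ℝ (Fin d)) :
    (fun t : {t : κ → ℝ // ∀ i, 0 < t i} =>
      (volume (∑ i, t.1 i • convexHull ℝ (Set.range (v i)))).toReal)
        ∈ homogeneousFunctions κ d := by
  have hconv : ∀ t : κ → ℝ, Convex ℝ (∑ i, t i • convexHull ℝ (Set.range (v i))) :=
    convex_sum_smul fun i => convex_convexHull ℝ _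
  by_cases hv : ∀ u, (∀ i k l, inner ℝ (v i k) u = inner ℝ (v i l) u) → u = 0
  · refine (isClosed_homogeneousFunctions κ d).mem_of_tendsto (b := atTop)
      (tendsto_pi_nhds.2 ?_) (Eventually.of_forall fun n : ℕ =>
        volume_image_closedBall_mem_homogeneousFunctions v hv n)
    rintro ⟨t, ht⟩
    set F := fun x => ∑ i, t i • gibbsMean (v i) x
    set K := ∑ i, t i • convexHull ℝ (Set.range (v i))
    have hfin : volume K ≠ ⊤ :=
      (isCompact_sum_smul (fun i => (Set.finite_range (v i)).isCompact_convexHull ℝ) t).measure_ne_top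
    have hvol : volume K = volume (⋃ n : ℕ, F '' Metric.closedBall 0 n) := by
      rw [← Set.image_iUnion, Metric.iUnion_closedBall_nat, Set.image_univ]
      refine le_antisymm ?_ (measure_mono
        (Set.range_subset_iff.2 (sum_smul_gibbsMean_mem v t)))
      rw [← measure_interior_of_null_frontier ((hconv t).addHaar_frontier volume)]
      exact measure_mono (interior_subset_range_sum_smul_gibbsMean v ht)
    refine (ENNReal.tendsto_toReal hfin).comp ?_
    rw [hvol]
    exact tendsto_measure_iUnion_atTop fun m n hmn =>
      Set.image_mono (Metric.closedBall_subset_closedBall (Nat.cast_le.2 hmn))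
  · push Not at hv
    obtain ⟨u, hu, hu0⟩ := hv
    convert (homogeneousFunctions κ d).zero_mem
    rename_i t
    obtain ⟨t, ht⟩ := t
    obtain ⟨k₀⟩ := ‹Nonempty ι›
    have hhull : ∀ i, ∀ p ∈ convexHull ℝ (Set.range (v i)),
        inner ℝ p u = inner ℝ (v i k₀) u := by
      intro i p hp
      refine convexHull_min ?_ (convex_hyperplane (f := fun y => inner ℝ y u)
        ⟨fun a b => inner_add_left a b u, fun c a => real_inner_smul_left a u c⟩ _) hp
      rintro _ ⟨k, rfl⟩
      exact hu i k k₀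
    rw [volume_eq_zero_of_inner_eq (hconv t) hu0 (c := ∑ i, t i * inner ℝ (v i k₀) u)]
    · rfl
    intro y hy
    obtain ⟨p, hp, rfl⟩ := mem_sum_smul_iff.1 hy
    simp only [sum_inner, real_inner_smul_left]
    exact Finset.sum_congr rfl fun i _ => by rw [hhull i _ (hp i)]

theorem volume_sum_smul_mem_homogeneousFunctions {d : ℕ}
    {P : κ → Set (EuclideanSpace ℝ (Fin d))} (hne : ∀ i, (P i).Nonempty)
    (hcpt : ∀ i, IsCompact (P i)) (hconv : ∀ i, Convex ℝ (P i)) :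
    (fun t : {t : κ → ℝ // ∀ i, 0 < t i} => (volume (∑ i, t.1 i • P i)).toReal)
      ∈ homogeneousFunctions κ d := by
  have hw : ∀ i, ∃ w : ℕ → EuclideanSpace ℝ (Fin d),
      (∀ k, w k ∈ P i) ∧ P i ⊆ closure (Set.range w) := by
    intro i
    have := (hne i).to_subtype
    refine ⟨fun k => (TopologicalSpace.denseSeq (P i) k : EuclideanSpace ℝ (Fin d)),
      fun k => Subtype.coe_prop _, fun p hp => ?_⟩
    have h := (TopologicalSpace.denseRange_denseSeq (P i)).closure_range
    have hp' := image_closure_subset_closure_image continuous_subtype_val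
      ⟨⟨p, hp⟩, h ▸ Set.mem_univ _, rfl⟩
    rwa [← Set.range_comp] at hp'
  choose w hwP hPw using hw
  let C : ℕ → κ → Set (EuclideanSpace ℝ (Fin d)) :=
    fun n i => convexHull ℝ (Set.range fun k : Fin (n + 1) => w i k)
  refine (isClosed_homogeneousFunctions κ d).mem_of_tendsto (b := atTop)
    (tendsto_pi_nhds.2 ?_) (Eventually.of_forall fun n : ℕ =>
      volume_polytopes_mem_homogeneousFunctions fun i (k : Fin (n + 1)) => w i k)
  rintro ⟨t, ht⟩
  change Tendsto (fun n => (volume (∑ i, t i • C n i)).toReal) atTop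
    (𝓝 (volume (∑ i, t i • P i)).toReal)
  have hCP : ∀ n i, C n i ⊆ P i := fun n i =>
    convexHull_min (Set.range_subset_iff.2 fun k => hwP i k) (hconv i)
  have hwC : ∀ i k n, k ≤ n → w i k ∈ C n i := fun i k n hkn =>
    subset_convexHull ℝ _ ⟨⟨k, Nat.lt_succ_of_le hkn⟩, rfl⟩
  have hC_mono : ∀ i, Monotone fun n => C n i := fun i m n hmn =>
    convexHull_min (Set.range_subset_iff.2 fun k =>
      hwC i k n ((Nat.le_of_lt_succ k.2).trans hmn)) (convex_convexHull ℝ _)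
  have hmono : Monotone fun n => ∑ i, t i • C n i := by
    intro m n hmn y hy
    obtain ⟨p, hp, rfl⟩ := mem_sum_smul_iff.1 hy
    exact mem_sum_smul_iff.2 ⟨p, fun i => hC_mono i hmn (hp i), rfl⟩
  have hS : Convex ℝ (⋃ n, ∑ i, t i • C n i) :=
    hmono.directed_le.convex_iUnion fun n => convex_sum_smul (fun i => convex_convexHull ℝ _) t
  have hdense : ∑ i, t i • P i ⊆ closure (⋃ n, ∑ i, t i • C n i) := by
    intro y hy
    obtain ⟨p, hp, rfl⟩ := mem_sum_smul_iff.1 hy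
    have hpcl : p ∈ closure (Set.univ.pi fun i => Set.range (w i)) := by
      rw [closure_pi_set]
      exact fun i _ => hPw i (hp i)
    have hsum : Continuous fun p : κ → EuclideanSpace ℝ (Fin d) => ∑ i, t i • p i := by fun_prop
    refine map_mem_closure (f := fun p => ∑ i, t i • p i) hsum hpcl fun q hq => ?_
    choose k hk using fun i => hq i (Set.mem_univ i)
    refine Set.mem_iUnion.2 ⟨Finset.univ.sup k, mem_sum_smul_iff.2 ⟨q, fun i => ?_, rfl⟩⟩
    rw [← hk i]
    exact hwC i (k i) _ (Finset.le_sup (Finset.mem_univ i))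
  have hvol : volume (∑ i, t i • P i) = volume (⋃ n, ∑ i, t i • C n i) := by
    refine le_antisymm ((measure_mono hdense).trans_eq ?_)
      (measure_mono (Set.iUnion_subset fun n y hy => ?_))
    · exact measure_closure_of_null_frontier (hS.addHaar_frontier volume)
    · obtain ⟨p, hp, rfl⟩ := mem_sum_smul_iff.1 hy
      exact mem_sum_smul_iff.2 ⟨p, fun i => hCP n i (hp i), rfl⟩
  refine (ENNReal.tendsto_toReal (isCompact_sum_smul hcpt t).measure_ne_top).comp ?_
  rw [hvol]
  exact tendsto_measure_iUnion_atTop hmono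

/-- The volume of a Minkowski combination is continuous from above in the coefficients. -/
theorem tendsto_volume_sum_add_smul {d : ℕ}
    {P : κ → Set (EuclideanSpace ℝ (Fin d))} (hne : ∀ i, (P i).Nonempty)
    (hcpt : ∀ i, IsCompact (P i)) (hconv : ∀ i, Convex ℝ (P i)) {t : κ → ℝ} (ht : ∀ i, 0 ≤ t i) :
    Tendsto (fun ε : ℝ => (volume (∑ i, (t i + ε) • P i)).toReal) (𝓝[>] 0)
      (𝓝 (volume (∑ i, t i • P i)).toReal) := by
  have hK := isCompact_sum_smul hcpt t
  choose c hc using hne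
  choose R hR using fun i => (hcpt i).isBounded.exists_norm_le
  have hlim : Tendsto (fun ε : ℝ => volume (Metric.cthickening (ε * ∑ i, R i) (∑ i, t i • P i)))
      (𝓝[>] 0) (𝓝 (volume (∑ i, t i • P i))) := by
    refine (tendsto_measure_cthickening_of_isCompact hK).comp ?_
    have h : Continuous fun ε : ℝ => ε * ∑ i, R i := by fun_prop
    simpa using (h.tendsto 0).mono_left nhdsWithin_le_nhds
  refine (ENNReal.tendsto_toReal hK.measure_ne_top).comp
    (tendsto_of_tendsto_of_tendsto_of_le_of_le' tendsto_const_nhds hlim ?_ ?_)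
  · filter_upwards [self_mem_nhdsWithin] with ε (hε : 0 < ε)
    rw [← measure_preimage_add_right volume (-(ε • ∑ i, c i)) (∑ i, t i • P i)]
    refine measure_mono fun y hy => ?_
    obtain ⟨p, hp, hpy⟩ := mem_sum_smul_iff.1 (Set.mem_preimage.1 hy)
    have hy' : y = ∑ i, (t i • p i + ε • c i) := by
      rw [Finset.sum_add_distrib, hpy, Finset.smul_sum, neg_add_cancel_right]
    rw [hy', mem_sum_smul_iff]
    have hq : ∀ i, ∃ q ∈ P i, (t i + ε) • q = t i • p i + ε • c i := fun i =>
      Set.mem_smul_set.1 <| by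
        rw [(hconv i).add_smul (ht i) hε.le]
        exact Set.add_mem_add (Set.smul_mem_smul_set (hp i)) (Set.smul_mem_smul_set (hc i))
    choose q hqP hq using hq
    exact ⟨q, hqP, Finset.sum_congr rfl fun i _ => hq i⟩
  · filter_upwards [self_mem_nhdsWithin] with ε (hε : 0 < ε)
    refine measure_mono fun y hy => ?_
    obtain ⟨p, hp, rfl⟩ := mem_sum_smul_iff.1 hy
    refine Metric.mem_cthickening_of_dist_le _ (∑ i, t i • p i) _ _
      (mem_sum_smul_iff.2 ⟨p, hp, rfl⟩) ?_
    simp_rw [dist_eq_norm, add_smul, Finset.sum_add_distrib, add_sub_cancel_left, Finset.mul_sum]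
    refine norm_sum_le_of_le _ fun i _ => ?_
    rw [norm_smul, Real.norm_of_nonneg hε.le]
    exact mul_le_mul_of_nonneg_left (hR i _ (hp i)) hε.le

end Volume

/-- Minkowski: given convex bodies `P_1, …, P_d` in `ℝ^d`, there is a real
polynomial `Q` in `d` variables, homogeneous of degree `d`, such that for all nonnegative
`t_1, …, t_d` the Lebesgue volume of `t_1 P_1 + ⋯ + t_d P_d` equals `Q(t_1, …, t_d)`. -/
theorem volume_minkowski_sum_polynomial (d : ℕ)
    (P : Fin d → Set (EuclideanSpace ℝ (Fin d)))
    (hne : ∀ i, (P i).Nonempty) (hcpt : ∀ i, IsCompact (P i))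
    (hconv : ∀ i, Convex ℝ (P i)) :
    ∃ Q : MvPolynomial (Fin d) ℝ, Q.IsHomogeneous d ∧
      ∀ t : Fin d → ℝ, (∀ i, 0 ≤ t i) →
        MvPolynomial.eval t Q = (volume (∑ i, t i • P i)).toReal := by
  obtain ⟨c, hc⟩ := (Submodule.mem_span_range_iff_exists_fun ℝ).1
    (volume_sum_smul_mem_homogeneousFunctions hne hcpt hconv)
  refine ⟨∑ φ, MvPolynomial.C (c φ) * ∏ j, MvPolynomial.X (φ j), ?_, fun t ht => ?_⟩
  · refine MvPolynomial.IsHomogeneous.sum _ _ _ fun φ _ => ?_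
    have h := (MvPolynomial.isHomogeneous_C (Fin d) (c φ)).mul
      (MvPolynomial.IsHomogeneous.prod Finset.univ (fun j => MvPolynomial.X (φ j)) (fun _ => 1)
        fun j _ => MvPolynomial.isHomogeneous_X ℝ (φ j))
    simpa using h
  · set Q : MvPolynomial (Fin d) ℝ := ∑ φ, MvPolynomial.C (c φ) * ∏ j, MvPolynomial.X (φ j)
      with hQ
    have hpos : ∀ s : Fin d → ℝ, (∀ i, 0 < s i) →
        MvPolynomial.eval s Q = (volume (∑ i, s i • P i)).toReal := by
      intro s hs
      have h := congrFun hc ⟨s, hs⟩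
      simpa [hQ, Finset.sum_apply] using h
    have hcont : Continuous fun ε : ℝ => MvPolynomial.eval (fun i => t i + ε) Q :=
      Q.continuous_eval.comp (by fun_prop)
    have hlim : Tendsto (fun ε : ℝ => MvPolynomial.eval (fun i => t i + ε) Q) (𝓝[>] 0)
        (𝓝 (MvPolynomial.eval t Q)) := by
      simpa using (hcont.tendsto 0).mono_left nhdsWithin_le_nhds
    refine tendsto_nhds_unique hlim
      ((tendsto_volume_sum_add_smul hne hcpt hconv ht).congr' ?_)
    filter_upwards [self_mem_nhdsWithin] with ε (hε : 0 < ε)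
    exact (hpos _ fun i => add_pos_of_nonneg_of_pos (ht i) hε).symm
end
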